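/- There exist a constant C > 0 and N₀ such that for every integer N ≥ N₀ the following holds: if a₁, …, a_d are pairwise distinct positive integers such that every nonempty subset sum Σ_{i∈F} a_i (F a nonempty subset of {1,…,d}) is a pure power at most N, then d ≤ C · (log log N)³ / log log log N. -/

import Mathlib

/-- A pure power is a positive integer of the form `a ^ n` with `a ≥ 1`, `n ≥ 2`. -/
def IsPurePower (m : ℕ) : Prop := ∃ a n : ℕ, 1 ≤ a ∧ 2 ≤ n ∧ m = a ^ n

theorem factorial_card_le_prod (S : Finset ℕ) (h : ∀ x ∈ S, 0 < x) :
    S.card.factorial ≤ ∏ x ∈ S, x := by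
  induction S using Finset.induction_on_max with
  | empty => simp
  | insert a s hs ih =>
    have hns : a ∉ s := fun h => lt_irrefl _ (hs a h)
    rw [Finset.card_insert_of_notMem hns, Finset.prod_insert hns, Nat.factorial_succ]
    refine Nat.mul_le_mul ?_ (ih fun x hx => h x (Finset.mem_insert_of_mem hx))
    have h1 : s ⊆ Finset.Ico 1 a := fun x hx =>
      Finset.mem_Ico.2 ⟨h x (Finset.mem_insert_of_mem hx), hs x hx⟩
    have h2 := Finset.card_le_card h1
    have h3 := h a (Finset.mem_insert_self _ _)
    simp at h2
    omega

theorem card_multiples_sq (K i : ℕ) :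
    ((Finset.Icc 1 K).filter (fun j => i * i ∣ j)).card = K / (i * i) := by
  rw [← Nat.Ioc_filter_dvd_card_eq_div]
  congr 1

theorem sum_div_sq_le (K n : ℕ) :
    ∑ i ∈ Finset.Ico 2 (n + 3), (K : ℝ) / (i * i) ≤ K * (3 / 4 - 1 / (n + 2)) := by
  have hK : (0:ℝ) ≤ K := Nat.cast_nonneg _
  induction n with
  | zero => norm_num; linarith
  | succ n ih =>
    rw [show n + 1 + 3 = (n + 3) + 1 by ring, Finset.sum_Ico_succ_top (by omega)]
    have : (K : ℝ) / (((n + 3 : ℕ) : ℝ) * ((n + 3 : ℕ) : ℝ)) ≤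
        K * (1 / (n + 2) - 1 / (((n + 1 : ℕ) : ℝ) + 2)) := by
      rw [div_eq_mul_one_div]
      refine mul_le_mul_of_nonneg_left ?_ hK
      push_cast
      rw [div_sub_div _ _ (by positivity) (by positivity), div_le_div_iff₀ (by positivity) (by positivity)]
      ring_nf
      nlinarith [(Nat.cast_nonneg n : (0:ℝ) ≤ n)]
    linarith

theorem card_squarefree_ge (K : ℕ) :
    K ≤ 4 * ((Finset.Icc 1 K).filter Squarefree).card := by
  classical
  have h1 : (Finset.Icc 1 K).filter (fun j => ¬ Squarefree j) ⊆
      (Finset.Ico 2 (K + 3)).biUnion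
        (fun i => (Finset.Icc 1 K).filter (fun j => i * i ∣ j)) := by
    intro j hj
    simp only [Finset.mem_filter, Finset.mem_Icc, Finset.mem_biUnion, Finset.mem_Ico] at hj ⊢
    obtain ⟨⟨h1, h2⟩, h3⟩ := hj
    unfold Squarefree at h3
    push Not at h3
    obtain ⟨i, hi, hi1⟩ := h3
    have h0 : i ≠ 0 := by rintro rfl; simp at hi; omega
    have h4 : i ≠ 1 := by rintro rfl; simp at hi1
    have h5 := Nat.le_of_dvd (by omega) hi
    have h6 : i ≤ i * i := Nat.le_mul_of_pos_left _ (by omega)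
    exact ⟨i, ⟨by omega, by omega⟩, ⟨h1, h2⟩, hi⟩
  have h2 : (((Finset.Icc 1 K).filter (fun j => ¬ Squarefree j)).card : ℝ) ≤ K * (3 / 4) := by
    calc (((Finset.Icc 1 K).filter (fun j => ¬ Squarefree j)).card : ℝ)
        ≤ ((∑ i ∈ Finset.Ico 2 (K + 3),
            ((Finset.Icc 1 K).filter (fun j => i * i ∣ j)).card : ℕ) : ℝ) := by
          exact_mod_cast (Finset.card_le_card h1).trans Finset.card_biUnion_le
      _ ≤ ∑ i ∈ Finset.Ico 2 (K + 3), (K : ℝ) / (i * i) := by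
          push_cast
          refine Finset.sum_le_sum fun i hi => ?_
          rw [card_multiples_sq]
          exact_mod_cast Nat.cast_div_le (α := ℝ) (m := K) (n := i * i)
      _ ≤ K * (3 / 4 - 1 / (K + 2)) := sum_div_sq_le K K
      _ ≤ _ := by
          refine mul_le_mul_of_nonneg_left ?_ (Nat.cast_nonneg _)
          have : (0:ℝ) ≤ 1 / (K + 2) := by positivity
          linarith
  have h3 := Finset.card_filter_add_card_filter_not (s := Finset.Icc 1 K) Squarefree
  simp only [Nat.card_Icc, Nat.add_sub_cancel] at h3
  have h4 : (((Finset.Icc 1 K).filter Squarefree).card : ℝ) +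
    (((Finset.Icc 1 K).filter (fun j => ¬ Squarefree j)).card : ℝ) = K := by exact_mod_cast h3
  have : (K : ℝ) ≤ 4 * ((Finset.Icc 1 K).filter Squarefree).card := by linarith
  exact_mod_cast this

theorem IsPurePower.exists_prime_dvd_factorization {m : ℕ} (h : IsPurePower m) :
    ∃ n, n.Prime ∧ ∀ p, n ∣ m.factorization p := by
  obtain ⟨a, k, -, hk, rfl⟩ := h
  refine ⟨k.minFac, Nat.minFac_prime (by omega), fun p => ?_⟩
  rw [Nat.factorization_pow]
  exact (Nat.minFac_dvd k).trans (by simp)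

/-- A homogeneous progression of pure powers is short. -/
theorem factorial_le_of_progression {N L x K : ℕ} (hx : 0 < x) (hN : N < 2 ^ L) (hK : 2 ≤ K)
    (h : ∀ j, 1 ≤ j → j ≤ K → IsPurePower (j * x) ∧ j * x ≤ N) :
    ∃ m, K ≤ 4 * m ∧ m.factorial ≤ L ^ 2 := by
  classical
  refine ⟨((Finset.Icc 1 K).filter Squarefree).card, card_squarefree_ge K, ?_⟩
  set S := (Finset.Icc 1 K).filter Squarefree with hS
  have hex : ∀ j : ℕ, ∃ n, 1 ≤ j → j ≤ K → n.Prime ∧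
      ∀ p, n ∣ j.factorization p + x.factorization p := by
    intro j
    by_cases hj : 1 ≤ j ∧ j ≤ K
    · obtain ⟨n, hn, hd⟩ := (h j hj.1 hj.2).1.exists_prime_dvd_factorization
      refine ⟨n, fun _ _ => ⟨hn, fun p => ?_⟩⟩
      have := hd p
      rwa [Nat.factorization_mul (by omega) (by omega), Finsupp.add_apply] at this
    · exact ⟨0, fun h1 h2 => absurd ⟨h1, h2⟩ hj⟩
  choose n hn using hex
  have hinj : Set.InjOn n S := by
    intro j hj j' hj' hjj
    simp only [hS, Finset.coe_filter, Finset.mem_Icc, Set.mem_ofPred_eq] at hj hj'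
    refine Nat.eq_of_factorization_eq (by omega) (by omega) fun p => ?_
    obtain ⟨h1, h2⟩ := hn j hj.1.1 hj.1.2
    obtain ⟨-, h4⟩ := hn j' hj'.1.1 hj'.1.2
    have h2 := h2 p
    have h4 := h4 p
    rw [← hjj] at h4
    have h5 := hj.2.natFactorization_le_one p
    have h6 := hj'.2.natFactorization_le_one p
    have h7 : ¬ n j ∣ 1 := fun hd => h1.one_lt.ne' (Nat.dvd_one.1 hd)
    by_contra hne
    rcases Nat.lt_or_gt_of_ne hne with hlt | hlt
    · apply h7
      have := Nat.dvd_sub h4 h2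
      rwa [show j'.factorization p + x.factorization p - (j.factorization p + x.factorization p)
        = 1 by omega] at this
    · apply h7
      have := Nat.dvd_sub h2 h4
      rwa [show j.factorization p + x.factorization p - (j'.factorization p + x.factorization p)
        = 1 by omega] at this
  have hv : x.factorization 2 ≠ 0 := by
    intro h0
    obtain ⟨h1, h2⟩ := hn 2 (by norm_num) hK
    have := h2 2
    rw [h0, Nat.Prime.factorization_self Nat.prime_two] at this
    exact h1.one_lt.ne' (Nat.dvd_one.1 this)
  have hvL : x.factorization 2 < L := by
    have h1 : 2 ^ x.factorization 2 ≤ x := Nat.ordProj_le 2 (by omega)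
    have h2 := (h 1 le_rfl (by omega)).2
    rw [one_mul] at h2
    exact (Nat.pow_lt_pow_iff_right (by norm_num)).1 (lt_of_le_of_lt (h1.trans h2) hN)
  have hdvd : ∏ q ∈ S.image n, q ∣ x.factorization 2 * (x.factorization 2 + 1) := by
    refine Finset.prod_primes_dvd _ ?_ ?_
    · intro q hq
      obtain ⟨j, hj, rfl⟩ := Finset.mem_image.1 hq
      simp only [hS, Finset.mem_filter, Finset.mem_Icc] at hj
      exact (hn j hj.1.1 hj.1.2).1.prime
    · intro q hq
      obtain ⟨j, hj, rfl⟩ := Finset.mem_image.1 hq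
      simp only [hS, Finset.mem_filter, Finset.mem_Icc] at hj
      have h1 := (hn j hj.1.1 hj.1.2).2 2
      have h2 := hj.2.natFactorization_le_one 2
      rcases Nat.le_one_iff_eq_zero_or_eq_one.1 h2 with h3 | h3
      · rw [h3, zero_add] at h1
        exact h1.mul_right _
      · rw [h3, add_comm] at h1
        exact h1.mul_left _
  calc S.card.factorial = (S.image n).card.factorial := by
        rw [Finset.card_image_of_injOn hinj]
    _ ≤ ∏ q ∈ S.image n, q := by
        refine factorial_card_le_prod _ fun q hq => ?_
        obtain ⟨j, hj, rfl⟩ := Finset.mem_image.1 hq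
        simp only [hS, Finset.mem_filter, Finset.mem_Icc] at hj
        exact (hn j hj.1.1 hj.1.2).1.pos
    _ ≤ x.factorization 2 * (x.factorization 2 + 1) :=
        Nat.le_of_dvd (by positivity) hdvd
    _ ≤ L ^ 2 := by rw [pow_two]; exact Nat.mul_le_mul (by omega) (by omega)

/-- A large family of sets of the same size and the same sum yields many pairwise disjoint sets
with a common positive sum. -/
theorem exists_pairwiseDisjoint_sum_eq {ι : Type*} [DecidableEq ι] (a : ι → ℕ)
    (ha : ∀ i, 0 < a i) (k : ℕ) (w : ℕ) :
    ∀ (F : Finset (Finset ι)) (σ : ℕ), (∀ s ∈ F, s.card = w ∧ ∑ i ∈ s, a i = σ) →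
      w.factorial * k ^ w < F.card →
      ∃ (x : ℕ) (D : Finset (Finset ι)), 0 < x ∧ k ≤ D.card ∧
        (D : Set (Finset ι)).PairwiseDisjoint id ∧ (∀ s ∈ D, ∑ i ∈ s, a i = x) ∧
        ∀ s ∈ D, ∃ t ∈ F, s ⊆ t := by
  induction w with
  | zero =>
    intro F σ hF hcard
    simp only [Nat.factorial_zero, pow_zero, mul_one] at hcard
    obtain ⟨s, hs, t, ht, hst⟩ := Finset.one_lt_card.1 hcard
    exact absurd ((Finset.card_eq_zero.1 (hF s hs).1).trans
      (Finset.card_eq_zero.1 (hF t ht).1).symm) hst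
  | succ w ih =>
    intro F σ hF hcard
    classical
    obtain ⟨D, hD, hmax⟩ := Finset.exists_max_image
      (F.powerset.filter fun D : Finset (Finset ι) => (D : Set (Finset ι)).PairwiseDisjoint id) Finset.card
      ⟨∅, by simp⟩
    simp only [Finset.mem_filter, Finset.mem_powerset] at hD hmax
    by_cases hk : k ≤ D.card
    · obtain ⟨s, hs⟩ : F.Nonempty := Finset.card_pos.1 (by omega)
      refine ⟨σ, D, ?_, hk, hD.2, fun s hs => (hF s (hD.1 hs)).2,
        fun s hs => ⟨s, hD.1 hs, subset_rfl⟩⟩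
      rw [← (hF s hs).2]
      exact Finset.sum_pos (fun i _ => ha i)
        (Finset.card_pos.1 (by rw [(hF s hs).1]; omega))
    · have hUcard : (D.biUnion id).card ≤ k * (w + 1) := by
        refine (Finset.card_biUnion_le_card_mul D id (w + 1) fun s hs =>
          (hF s (hD.1 hs)).1.le).trans ?_
        exact Nat.mul_le_mul_right _ (by omega)
      have hmeet : ∀ s ∈ F, ∃ u ∈ D.biUnion id, u ∈ s := by
        intro s hs
        by_contra! hno
        have hdisj : ∀ t ∈ D, Disjoint s t := by
          intro t ht
          rw [Finset.disjoint_left]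
          intro u hu hut
          exact hno u (Finset.mem_biUnion.2 ⟨t, ht, hut⟩) hu
        have hsD : s ∉ D := by
          intro hsD
          have h1 : s = ∅ := by simpa using hdisj s hsD
          have := (hF s hs).1
          rw [h1] at this
          simp at this
        have h2 := hmax (insert s D) ⟨Finset.insert_subset hs hD.1, by
          rw [Finset.coe_insert]
          exact hD.2.insert fun t ht _ => hdisj t ht⟩
        rw [Finset.card_insert_of_notMem hsD] at h2
        omega
      obtain ⟨u, -, hu⟩ : ∃ u ∈ D.biUnion id,
          w.factorial * k ^ w < (F.filter (u ∈ ·)).card := by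
        by_contra! hno
        have h1 : F ⊆ (D.biUnion id).biUnion fun u => F.filter (u ∈ ·) := by
          intro s hs
          obtain ⟨u, hu, hus⟩ := hmeet s hs
          exact Finset.mem_biUnion.2 ⟨u, hu, Finset.mem_filter.2 ⟨hs, hus⟩⟩
        have h2 := (Finset.card_le_card h1).trans
          (Finset.card_biUnion_le_card_mul _ _ _ hno)
        have h3 : (D.biUnion id).card * (w.factorial * k ^ w) ≤
            (w + 1).factorial * k ^ (w + 1) := by
          refine (Nat.mul_le_mul_right _ hUcard).trans (le_of_eq ?_)
          rw [Nat.factorial_succ, pow_succ]; ring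
        omega
      obtain ⟨x, E, hx, hE, hEd, hEs, hEF⟩ := ih ((F.filter (u ∈ ·)).image (Finset.erase · u))
        (σ - a u) (by
          intro s hs
          obtain ⟨t, ht, rfl⟩ := Finset.mem_image.1 hs
          obtain ⟨ht, hut⟩ := Finset.mem_filter.1 ht
          refine ⟨by rw [Finset.card_erase_of_mem hut, (hF t ht).1]; rfl, ?_⟩
          rw [← (hF t ht).2, ← Finset.sum_erase_add t a hut]
          simp) (by
          rw [Finset.card_image_of_injOn]
          · exact hu
          · intro s hs t ht hst
            have hs := (Finset.mem_filter.1 hs).2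
            have ht := (Finset.mem_filter.1 ht).2
            simp only at hst
            rw [← Finset.insert_erase hs, hst, Finset.insert_erase ht])
      refine ⟨x, E, hx, hE, hEd, hEs, fun s hs => ?_⟩
      obtain ⟨t, ht, hst⟩ := hEF s hs
      obtain ⟨t', ht', rfl⟩ := Finset.mem_image.1 ht
      exact ⟨t', (Finset.mem_filter.1 ht').1, hst.trans (Finset.erase_subset _ _)⟩

/-- If there are few subset sums, then they contain a long homogeneous progression. -/
theorem exists_progression_subset_sums {ι : Type*} [DecidableEq ι] (a : ι → ℕ)
    (ha : ∀ i, 0 < a i) (H : Finset ι) (T : Finset ℕ)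
    (hT : ∀ s ⊆ H, s.Nonempty → ∑ i ∈ s, a i ∈ T) (k w : ℕ) (hw : 0 < w)
    (h : T.card * (w.factorial * k ^ w) < H.card.choose w) :
    ∃ x, 0 < x ∧ ∀ j, 1 ≤ j → j ≤ k →
      ∃ s : Finset ι, s ⊆ H ∧ s.Nonempty ∧ ∑ i ∈ s, a i = j * x := by
  rw [← Finset.card_powersetCard] at h
  obtain ⟨σ, -, hσ⟩ := Finset.exists_lt_card_fiber_of_mul_lt_card_of_maps_to
    (f := fun s => ∑ i ∈ s, a i) (fun s hs => by
      obtain ⟨h1, h2⟩ := Finset.mem_powersetCard.1 hs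
      exact hT s h1 (Finset.card_pos.1 (by omega))) h
  obtain ⟨x, D, hx, hk, hD, hsum, hsub⟩ := exists_pairwiseDisjoint_sum_eq a ha k w _ σ
    (fun s hs => by
      obtain ⟨h1, h2⟩ := Finset.mem_filter.1 hs
      exact ⟨(Finset.mem_powersetCard.1 h1).2, h2⟩) hσ
  refine ⟨x, hx, fun j hj hjk => ?_⟩
  obtain ⟨E, hE, hEc⟩ := Finset.exists_subset_card_eq (hjk.trans hk)
  have hs : ∑ i ∈ E.biUnion id, a i = j * x := by
    rw [Finset.sum_biUnion (hD.subset (by exact_mod_cast hE))]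
    refine (Finset.sum_congr rfl fun s hs => hsum s (hE hs)).trans ?_
    rw [Finset.sum_const, hEc, smul_eq_mul]
  refine ⟨E.biUnion id, ?_, ?_, hs⟩
  · refine Finset.biUnion_subset.2 fun s hs => ?_
    obtain ⟨t, ht, hst⟩ := hsub s (hE hs)
    exact hst.trans (Finset.mem_powersetCard.1 (Finset.mem_filter.1 ht).1).1
  · rw [Finset.nonempty_iff_ne_empty]
    intro h0
    rw [h0, Finset.sum_empty] at hs
    have : 0 < j * x := Nat.mul_pos hj hx
    omega

open Filter Topology in
theorem lt_analyticOrderAt_sum {ι : Type*} {f : ι → ℝ → ℝ} {z : ℝ} {e : ℕ∞}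
    (he : e ≠ ⊤) (s : Finset ι) (h : ∀ i ∈ s, e < analyticOrderAt (f i) z) :
    e < analyticOrderAt (∑ i ∈ s, f i) z := by
  classical
  induction s using Finset.induction_on with
  | empty =>
    have : analyticOrderAt (0 : ℝ → ℝ) z = ⊤ := analyticOrderAt_eq_top.2 (by simp)
    rw [Finset.sum_empty, this]
    exact lt_top_iff_ne_top.2 he
  | insert i s his ih =>
    rw [Finset.sum_insert his]
    exact lt_of_lt_of_le (lt_min (h i (Finset.mem_insert_self _ _))
      (ih fun j hj => h j (Finset.mem_insert_of_mem hj))) le_analyticOrderAt_add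

open Filter Topology in
/-- Functions of the form `y ^ j * g j (y ^ n + x₀)` with distinct `j < n` have orders at `0` in
distinct residue classes, so they cannot cancel. -/
theorem eventually_eq_zero_of_sum_pow_mul_eq_zero {n : ℕ} (hn : 0 < n) (g : Fin n → ℝ → ℝ)
    (x₀ : ℝ) (hg : ∀ j, AnalyticAt ℝ (g j) x₀)
    (h : ∀ y : ℝ, 0 < y → ∑ j : Fin n, y ^ (j : ℕ) * g j (y ^ n + x₀) = 0) (j : Fin n) :
    ∀ᶠ x in 𝓝 x₀, g j x = 0 := by
  classical
  set f : Fin n → ℝ → ℝ := fun j y => y ^ (j : ℕ) * g j (y ^ n + x₀) with hf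
  have hx : (fun y : ℝ => y ^ n + x₀) 0 = x₀ := by simp [hn.ne']
  have hpow : ∀ m : ℕ, analyticOrderAt (fun y : ℝ => y ^ m) 0 = m := by
    intro m
    have := analyticOrderAt_pow (𝕜 := ℝ) (f := id) (z₀ := 0) analyticAt_id m
    rw [analyticOrderAt_id] at this
    have hid : (id ^ m : ℝ → ℝ) = fun y => y ^ m := rfl
    rw [hid] at this
    simpa using this
  have hga : ∀ j, AnalyticAt ℝ (g j) ((fun y : ℝ => y ^ n + x₀) 0) := by
    intro j; rw [hx]; exact hg j
  have hin : AnalyticAt ℝ (fun y : ℝ => y ^ n + x₀) 0 := by fun_prop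
  have hcomp : ∀ j, AnalyticAt ℝ (g j ∘ fun y : ℝ => y ^ n + x₀) 0 :=
    fun j => AnalyticAt.comp (g := g j) (f := fun y : ℝ => y ^ n + x₀) (hga j) hin
  have hfa : ∀ j, AnalyticAt ℝ (f j) 0 := by
    intro j
    exact AnalyticAt.mul (f := fun y : ℝ => y ^ (j : ℕ)) (by fun_prop) (hcomp j)
  have hord : ∀ j : Fin n, analyticOrderAt (f j) 0 = (j : ℕ) + n * analyticOrderAt (g j) x₀ := by
    intro j
    have h1 : f j = (fun y : ℝ => y ^ (j : ℕ)) * (g j ∘ fun y : ℝ => y ^ n + x₀) := rfl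
    have h2 : (fun y : ℝ => (fun y : ℝ => y ^ n + x₀) y - (fun y : ℝ => y ^ n + x₀) 0)
        = fun y => y ^ n := by
      rw [hx]; funext y; simp
    rw [h1, analyticOrderAt_mul (by fun_prop) (hcomp j), hpow, AnalyticAt.analyticOrderAt_comp (f := g j) (g := fun y : ℝ => y ^ n + x₀) (hga j) hin,
      h2, hpow, mul_comm]
    exact congrArg (fun z => ((j : ℕ) : ℕ∞) + n * analyticOrderAt (g j) z) hx
  have hsum : AnalyticAt ℝ (∑ j, f j) 0 := by
    exact Finset.analyticAt_sum _ fun j _ => hfa j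
  have hzero : ∀ᶠ y in 𝓝 (0 : ℝ), (∑ j, f j) y = 0 := by
    refine hsum.frequently_zero_iff_eventually_zero.1 ?_
    have h1 : ∃ᶠ y in 𝓝[>] (0 : ℝ), (∑ j, f j) y = 0 := by
      refine Eventually.frequently ?_
      filter_upwards [self_mem_nhdsWithin] with y hy
      simpa [hf] using h y hy
    exact h1.filter_mono (nhdsWithin_mono _ fun y hy => ne_of_gt hy)
  by_contra hj
  have hj' : analyticOrderAt (g j) x₀ ≠ ⊤ := fun ht => hj (analyticOrderAt_eq_top.1 ht)
  obtain ⟨i, -, hi⟩ := Finset.exists_min_image Finset.univ (fun i => analyticOrderAt (f i) 0)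
    ⟨j, Finset.mem_univ j⟩
  have htop : analyticOrderAt (f j) 0 ≠ ⊤ := by
    rw [hord]
    lift analyticOrderAt (g j) x₀ to ℕ using hj' with m
    exact_mod_cast ENat.natCast_ne_top ((j : ℕ) + n * m)
  have hitop : analyticOrderAt (f i) 0 ≠ ⊤ := ne_top_of_le_ne_top htop (hi j (Finset.mem_univ _))
  have hlt : ∀ k ∈ Finset.univ.erase i, analyticOrderAt (f i) 0 < analyticOrderAt (f k) 0 := by
    intro k hk
    refine lt_of_le_of_ne (hi k (Finset.mem_univ _)) fun heq => (Finset.mem_erase.1 hk).1 ?_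
    have hktop := heq ▸ hitop
    rw [hord, hord] at heq
    rw [hord] at hitop hktop
    have hfin : ∀ l : Fin n, ((l : ℕ) : ℕ∞) + n * analyticOrderAt (g l) x₀ ≠ ⊤ →
        analyticOrderAt (g l) x₀ ≠ ⊤ := by
      intro l hl ht
      rw [ht, ENat.mul_top (by exact_mod_cast hn.ne')] at hl
      simp at hl
    have h1 := hfin i hitop
    have h2 := hfin k hktop
    lift analyticOrderAt (g i) x₀ to ℕ using h1 with m
    lift analyticOrderAt (g k) x₀ to ℕ using h2 with m'
    norm_cast at heq
    have h3 := congrArg (· % n) heq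
    simp only [Nat.add_mul_mod_self_left, Nat.mod_eq_of_lt i.2, Nat.mod_eq_of_lt k.2] at h3
    exact Fin.ext h3.symm
  have h1 := lt_analyticOrderAt_sum hitop _ hlt
  have h2 : analyticOrderAt (∑ j, f j) 0 = analyticOrderAt (f i) 0 := by
    rw [← Finset.add_sum_erase _ _ (Finset.mem_univ i)]
    exact analyticOrderAt_add_eq_left_of_lt h1
  exact hitop (h2 ▸ analyticOrderAt_eq_top.2 hzero)

/-- A product of `n`-th roots of translates. -/
noncomputable def rootProd {t : ℕ} (n : ℕ) (a : Fin t → ℝ) (α : Fin t → Fin n) (x : ℝ) : ℝ :=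
  ∏ i, (x + a i) ^ (((α i : ℕ) : ℝ) / n)

theorem analyticAt_rootProd {t n : ℕ} (a : Fin t → ℝ) (α : Fin t → Fin n) (x : ℝ)
    (hx : ∀ i, 0 < x + a i) : AnalyticAt ℝ (rootProd n a α) x := by
  refine Finset.analyticAt_fun_prod _ fun i _ => ?_
  have h1 : AnalyticAt ℝ (fun y => Real.exp (Real.log (y + a i) * (((α i : ℕ) : ℝ) / n))) x :=
    (((by fun_prop : AnalyticAt ℝ (fun y => y + a i) x).log (hx i)).mul analyticAt_const).rexp
  refine h1.congr ?_
  have h2 : ∀ᶠ y in nhds x, -a i < y := Ioi_mem_nhds (by linarith [hx i])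
  filter_upwards [h2] with y hy
  rw [Real.rpow_def_of_pos (by linarith)]

theorem analyticAt_sum_rootProd {t n : ℕ} (a : Fin t → ℝ) (c : (Fin t → Fin n) → ℝ) (x : ℝ)
    (hx : ∀ i, 0 < x + a i) : AnalyticAt ℝ (fun x => ∑ α, c α * rootProd n a α x) x :=
  Finset.analyticAt_fun_sum _ fun α _ => analyticAt_const.mul (analyticAt_rootProd a α x hx)

open Filter Topology in
theorem rootProd_linearIndependent {n : ℕ} (hn : 0 < n) : ∀ (t : ℕ) (a : Fin t → ℝ),
    StrictMono a → ∀ c : (Fin t → Fin n) → ℝ,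
      (∀ᶠ x in atTop, ∑ α, c α * rootProd n a α x = 0) → ∀ α, c α = 0 := by
  intro t
  induction t with
  | zero =>
    intro a _ c h α
    obtain ⟨x, hx⟩ := h.exists
    rw [Fintype.sum_unique] at hx
    simpa [rootProd, Subsingleton.elim α default] using hx
  | succ t ih =>
    intro a ha c h α
    set G : Fin n → ℝ → ℝ := fun j x =>
      ∑ β : Fin t → Fin n, c (Fin.cons j β) * rootProd n (fun i => a i.succ) β x with hG
    have hpos : ∀ x, -a 0 ≤ x → ∀ i : Fin t, 0 < x + a i.succ := by
      intro x hx i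
      have := ha (Fin.succ_pos i)
      linarith
    have hF : ∀ x, ∑ α, c α * rootProd n a α x =
        ∑ j : Fin n, (x + a 0) ^ (((j : ℕ) : ℝ) / n) * G j x := by
      intro x
      rw [← (Fin.consEquiv fun _ => Fin n).sum_comp, Fintype.sum_prod_type]
      refine Finset.sum_congr rfl fun j _ => ?_
      rw [hG, Finset.mul_sum]
      refine Finset.sum_congr rfl fun β _ => ?_
      have h1 : (Fin.consEquiv fun _ => Fin n) (j, β) = (Fin.cons j β : Fin (t + 1) → Fin n) := rfl
      rw [h1]
      simp only [rootProd, Fin.prod_univ_succ, Fin.cons_zero, Fin.cons_succ]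
      ring
    have hFan : AnalyticOnNhd ℝ (fun x => ∑ α, c α * rootProd n a α x) (Set.Ioi (-a 0)) := by
      intro x hx
      refine analyticAt_sum_rootProd a c x fun i => ?_
      have h1 : a 0 ≤ a i := ha.monotone (Fin.zero_le i)
      have h2 : -a 0 < x := hx
      linarith
    have hFz : Set.EqOn (fun x => ∑ α, c α * rootProd n a α x) 0 (Set.Ioi (-a 0)) := by
      obtain ⟨X, hX⟩ := eventually_atTop.1 h
      have hz : max (-a 0) X + 1 ∈ Set.Ioi (-a 0) := by
        have := le_max_left (-a 0) X
        simp only [Set.mem_Ioi]; linarith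
      refine hFan.eqOn_zero_of_preconnected_of_eventuallyEq_zero isPreconnected_Ioi hz ?_
      have : X < max (-a 0) X + 1 := by
        have := le_max_right (-a 0) X
        linarith
      filter_upwards [Ioi_mem_nhds this] with y hy
      exact hX y (le_of_lt hy)
    have hGan : ∀ j, AnalyticOnNhd ℝ (G j) (Set.Ici (-a 0)) := fun j x hx =>
      analyticAt_sum_rootProd _ _ x (hpos x hx)
    have hGz : ∀ j, ∀ᶠ x in 𝓝 (-a 0), G j x = 0 := by
      refine eventually_eq_zero_of_sum_pow_mul_eq_zero hn G (-a 0)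
        (fun j => hGan j _ (Set.mem_Ici.2 le_rfl)) fun y hy => ?_
      have h1 := hFz (x := y ^ n + -a 0) (by simp only [Set.mem_Ioi]; have := pow_pos hy n; linarith)
      simp only [hF, Pi.zero_apply] at h1
      rw [← h1]
      refine Finset.sum_congr rfl fun j _ => ?_
      congr 1
      rw [neg_add_cancel_right, ← Real.rpow_natCast y n, ← Real.rpow_mul hy.le,
        mul_div_cancel₀ _ (by exact_mod_cast hn.ne'), Real.rpow_natCast]
    have hGz' : ∀ j, Set.EqOn (G j) 0 (Set.Ici (-a 0)) := fun j =>
      (hGan j).eqOn_zero_of_preconnected_of_eventuallyEq_zero isPreconnected_Ici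
        (Set.mem_Ici.2 le_rfl) (hGz j)
    have := ih (fun i => a i.succ) (fun i j hij => ha (Fin.succ_lt_succ_iff.2 hij))
      (fun β => c (Fin.cons (α 0) β)) (by
        filter_upwards [eventually_ge_atTop (-a 0)] with x hx
        exact hGz' (α 0) hx) (Fin.tail α)
    simpa using this

/-- The span of the monomials `X ^ m * ∏ i, u i ^ α i` with `m ≤ D` and `α i < n`. -/
def monomialSpan {E : Type*} [CommRing E] [Algebra ℝ E] {t : ℕ} (n : ℕ) (X : E) (u : Fin t → E)
    (D : ℕ) : Submodule ℝ E :=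
  Submodule.span ℝ (Set.range fun p : Fin (D + 1) × (Fin t → Fin n) =>
    X ^ (p.1 : ℕ) * ∏ i, u i ^ (p.2 i : ℕ))

section monomialSpan

variable {E : Type*} [CommRing E] [Algebra ℝ E] {t n : ℕ} {X : E} {u : Fin t → E}

theorem monomial_mem_monomialSpan {D m : ℕ} (hm : m ≤ D) (α : Fin t → Fin n) :
    X ^ m * ∏ i, u i ^ (α i : ℕ) ∈ monomialSpan n X u D :=
  Submodule.subset_span ⟨(⟨m, Nat.lt_succ_of_le hm⟩, α), rfl⟩

theorem mul_mem_monomialSpan {y : E} {D D' : ℕ}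
    (h : ∀ m ≤ D, ∀ α : Fin t → Fin n,
      y * (X ^ m * ∏ i, u i ^ (α i : ℕ)) ∈ monomialSpan n X u D')
    {f : E} (hf : f ∈ monomialSpan n X u D) : y * f ∈ monomialSpan n X u D' := by
  have h1 : monomialSpan n X u D ≤ (monomialSpan n X u D').comap (LinearMap.mulLeft ℝ y) := by
    refine Submodule.span_le.2 ?_
    rintro _ ⟨p, rfl⟩
    exact h p.1 (Nat.le_of_lt_succ p.1.2) p.2
  exact h1 hf

theorem monomialSpan_mono {D D' : ℕ} (h : D ≤ D') :
    monomialSpan n X u D ≤ monomialSpan n X u D' := by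
  refine Submodule.span_le.2 ?_
  rintro _ ⟨p, rfl⟩
  exact monomial_mem_monomialSpan ((Nat.le_of_lt_succ p.1.2).trans h) p.2

theorem X_mul_mem_monomialSpan {D : ℕ} {f : E} (hf : f ∈ monomialSpan n X u D) :
    X * f ∈ monomialSpan n X u (D + 1) := by
  refine mul_mem_monomialSpan (fun m hm α => ?_) hf
  rw [← mul_assoc, ← pow_succ']
  exact monomial_mem_monomialSpan (by omega) α

theorem root_mul_mem_monomialSpan {a : Fin t → ℝ} (hu : ∀ i, u i ^ n = X + algebraMap ℝ E (a i))
    (i : Fin t) {D : ℕ} {f : E} (hf : f ∈ monomialSpan n X u D) :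
    u i * f ∈ monomialSpan n X u (D + 1) := by
  refine mul_mem_monomialSpan (fun m hm α => ?_) hf
  have hprod : ∀ β : Fin t → Fin n, ∏ j, u j ^ (β j : ℕ) =
      u i ^ (β i : ℕ) * ∏ j ∈ Finset.univ.erase i, u j ^ (β j : ℕ) := fun β =>
    (Finset.mul_prod_erase _ _ (Finset.mem_univ i)).symm
  have hupd : ∀ r : Fin n, ∏ j ∈ Finset.univ.erase i, u j ^ (Function.update α i r j : ℕ) =
      ∏ j ∈ Finset.univ.erase i, u j ^ (α j : ℕ) := by
    intro r
    refine Finset.prod_congr rfl fun j hj => ?_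
    rw [Function.update_of_ne (Finset.mem_erase.1 hj).1]
  by_cases h : (α i : ℕ) + 1 < n
  · have h1 : u i * (X ^ m * ∏ j, u j ^ (α j : ℕ)) =
        X ^ m * ∏ j, u j ^ (Function.update α i ⟨(α i : ℕ) + 1, h⟩ j : ℕ) := by
      rw [hprod, hprod (Function.update α i _), hupd]
      simp only [Function.update_self]
      ring
    rw [h1]
    exact monomial_mem_monomialSpan (by omega) _
  · have h0 : 0 < n := lt_of_le_of_lt (Nat.zero_le _) (α i).2
    have hn : (α i : ℕ) + 1 = n := by have := (α i).2; omega
    have h1 : u i * (X ^ m * ∏ j, u j ^ (α j : ℕ)) =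
        X ^ (m + 1) * ∏ j, u j ^ (Function.update α i ⟨0, h0⟩ j : ℕ) +
        a i • (X ^ m * ∏ j, u j ^ (Function.update α i ⟨0, h0⟩ j : ℕ)) := by
      rw [hprod, hprod (Function.update α i _), hupd]
      simp only [Function.update_self, pow_zero, one_mul, Algebra.smul_def]
      have h2 : u i * u i ^ (α i : ℕ) = X + algebraMap ℝ E (a i) := by
        rw [← pow_succ', hn, hu]
      linear_combination (X ^ m * ∏ j ∈ Finset.univ.erase i, u j ^ (α j : ℕ)) * h2
    rw [h1]
    exact add_mem (monomial_mem_monomialSpan (by omega) _)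
      (Submodule.smul_mem _ _ (monomial_mem_monomialSpan (by omega) _))

theorem root_pow_mul_mem_monomialSpan {a : Fin t → ℝ}
    (hu : ∀ i, u i ^ n = X + algebraMap ℝ E (a i))
    (i : Fin t) (k : ℕ) {D : ℕ} {f : E} (hf : f ∈ monomialSpan n X u D) :
    u i ^ k * f ∈ monomialSpan n X u (D + k) := by
  induction k with
  | zero => simpa using hf
  | succ k ih =>
    rw [pow_succ', mul_assoc]
    exact root_mul_mem_monomialSpan hu i ih

theorem prod_root_pow_mul_mem_monomialSpan {a : Fin t → ℝ}
    (hu : ∀ i, u i ^ n = X + algebraMap ℝ E (a i)) (α : Fin t → Fin n) (s : Finset (Fin t))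
    {D : ℕ} {f : E} (hf : f ∈ monomialSpan n X u D) :
    (∏ i ∈ s, u i ^ (α i : ℕ)) * f ∈ monomialSpan n X u (D + s.card * n) := by
  classical
  induction s using Finset.induction_on with
  | empty => simpa using hf
  | insert i s his ih =>
    rw [Finset.prod_insert his, mul_assoc, Finset.card_insert_of_notMem his]
    refine monomialSpan_mono ?_ (root_pow_mul_mem_monomialSpan hu i (α i) ih)
    have := (α i).2
    rw [Nat.succ_mul]
    omega

theorem comb_mul_mem_monomialSpan {a : Fin t → ℝ}
    (hu : ∀ i, u i ^ n = X + algebraMap ℝ E (a i)) (c : (Fin t → Fin n) → ℝ)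
    {D : ℕ} {f : E} (hf : f ∈ monomialSpan n X u D) :
    (∑ α : Fin t → Fin n, c α • ∏ i, u i ^ (α i : ℕ)) * f ∈
      monomialSpan n X u (D + t * n) := by
  rw [Finset.sum_mul]
  refine sum_mem fun α _ => ?_
  rw [smul_mul_assoc]
  refine Submodule.smul_mem _ _ ?_
  simpa using prod_root_pow_mul_mem_monomialSpan hu α Finset.univ hf

/-- A combination of products of `n`-th roots satisfies a polynomial relation of controlled
degree. -/
theorem exists_relation (hn : 0 < n) {a : Fin t → ℝ}
    (hu : ∀ i, u i ^ n = X + algebraMap ℝ E (a i)) (c : (Fin t → Fin n) → ℝ) :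
    ∃ (J : ℕ) (l : Fin (2 * t * n * n ^ t + 1) × Fin (J + 1) → ℝ), (∃ p, l p ≠ 0) ∧
      ∑ p, l p • (X ^ (p.1 : ℕ) *
        (∑ α : Fin t → Fin n, c α • ∏ i, u i ^ (α i : ℕ)) ^ (p.2 : ℕ)) = 0 := by
  classical
  set F := ∑ α : Fin t → Fin n, c α • ∏ i, u i ^ (α i : ℕ) with hF
  set I := 2 * t * n * n ^ t with hI
  set J := 2 * n ^ t with hJ
  refine ⟨J, ?_⟩
  have hFj : ∀ j : ℕ, F ^ j ∈ monomialSpan n X u (j * (t * n)) := by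
    intro j
    induction j with
    | zero =>
      have := monomial_mem_monomialSpan (X := X) (u := u) (Nat.zero_le (0 * (t * n)))
        (fun _ => (⟨0, hn⟩ : Fin n))
      simpa using this
    | succ j ih =>
      rw [pow_succ', Nat.succ_mul]
      exact comb_mul_mem_monomialSpan hu c ih
  have hXF : ∀ i j : ℕ, X ^ i * F ^ j ∈ monomialSpan n X u (j * (t * n) + i) := by
    intro i j
    induction i with
    | zero => simpa using hFj j
    | succ i ih =>
      rw [pow_succ', mul_assoc]
      exact X_mul_mem_monomialSpan ih
  have hdep : ¬ LinearIndependent ℝ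
      (fun p : Fin (I + 1) × Fin (J + 1) => X ^ (p.1 : ℕ) * F ^ (p.2 : ℕ)) := by
    intro hli
    have h1 := linearIndependent_le_span_aux' _ hli
      (Set.range fun p : Fin (J * (t * n) + I + 1) × (Fin t → Fin n) =>
        X ^ (p.1 : ℕ) * ∏ i, u i ^ (p.2 i : ℕ)) (by
        rintro _ ⟨p, rfl⟩
        refine monomialSpan_mono ?_ (hXF p.1 p.2)
        have h1 := Nat.le_of_lt_succ p.1.2
        have h2 := Nat.mul_le_mul_right (t * n) (Nat.le_of_lt_succ p.2.2)
        omega)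
    have h2 := h1.trans (Fintype.card_range_le _)
    simp only [Fintype.card_prod, Fintype.card_fin, Fintype.card_fun] at h2
    have h3 : J * (t * n) = I := by rw [hI, hJ]; ring
    rw [h3, hJ] at h2
    have h4 : 0 < n ^ t := pow_pos hn t
    nlinarith
  obtain ⟨l, hl, p, hp⟩ := Fintype.not_linearIndependent_iff.1 hdep
  exact ⟨l, ⟨p, hp⟩, hl⟩

end monomialSpan

open Filter Topology Polynomial in
/-- If `F` is analytic on `(0, ∞)`, not identically zero, and satisfies a nontrivial polynomial
relation of degree at most `I` in `x`, then it has at most `I` zeros. -/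
theorem card_zeros_le_of_relation {F : ℝ → ℝ} (hF : AnalyticOnNhd ℝ F (Set.Ioi 0))
    (hne : ∃ x, 0 < x ∧ F x ≠ 0) {I J : ℕ} (l : Fin (I + 1) × Fin (J + 1) → ℝ)
    (hl : ∃ p, l p ≠ 0)
    (hrel : ∀ x, 0 < x → ∑ p, l p * (x ^ (p.1 : ℕ) * F x ^ (p.2 : ℕ)) = 0)
    (Z : Finset ℝ) (hZ : ∀ x ∈ Z, 0 < x ∧ F x = 0) : Z.card ≤ I := by
  classical
  set q : Fin (J + 1) → ℝ[X] := fun j => ∑ i : Fin (I + 1), C (l (i, j)) * X ^ (i : ℕ) with hq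
  have hqdeg : ∀ j, (q j).natDegree ≤ I := fun j =>
    natDegree_sum_le_of_forall_le _ _ fun i _ =>
      (natDegree_C_mul_X_pow_le _ _).trans (Nat.le_of_lt_succ i.2)
  have hqeval : ∀ j x, (q j).eval x = ∑ i : Fin (I + 1), l (i, j) * x ^ (i : ℕ) := by
    intro j x
    simp [hq, eval_finsetSum]
  have hqne : ∃ j, q j ≠ 0 := by
    obtain ⟨⟨i, j⟩, hp⟩ := hl
    refine ⟨j, fun h0 => hp ?_⟩
    have := congrArg (fun p => coeff p (i : ℕ)) h0
    simp only [hq, finsetSum_coeff, coeff_C_mul, coeff_X_pow, coeff_zero] at this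
    rw [Finset.sum_eq_single i] at this
    · simpa using this
    · intro k _ hk
      rw [if_neg fun h => hk (Fin.ext h.symm), mul_zero]
    · simp
  obtain ⟨j₀, hj₀, hmin⟩ := Finset.exists_min_image (Finset.univ.filter fun j => q j ≠ 0) id
    (by obtain ⟨j, hj⟩ := hqne; exact ⟨j, by simpa using hj⟩)
  simp only [Finset.mem_filter, Finset.mem_univ, true_and, id] at hj₀ hmin
  have hlow : ∀ j, j < j₀ → q j = 0 := by
    intro j hj
    by_contra h
    exact absurd (hmin j h) (not_le.2 hj)
  set Q : ℝ → ℝ := fun x => ∑ j, (q j).eval x * F x ^ ((j : ℕ) - (j₀ : ℕ)) with hQ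
  have hFQ : ∀ x, 0 < x → F x ^ (j₀ : ℕ) * Q x = 0 := by
    intro x hx
    rw [← hrel x hx, Fintype.sum_prod_type_right, hQ, Finset.mul_sum]
    refine Finset.sum_congr rfl fun j _ => ?_
    by_cases hj : j < j₀
    · have h1 := hqeval j x
      rw [hlow j hj, eval_zero] at h1
      rw [hlow j hj, eval_zero, zero_mul, mul_zero]
      simp only [← mul_assoc, ← Finset.sum_mul, ← h1, zero_mul]
    · have hj : (j₀ : ℕ) ≤ j := not_lt.1 hj
      rw [hqeval, mul_left_comm, ← pow_add, Nat.add_sub_cancel' hj, Finset.sum_mul]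
      exact Finset.sum_congr rfl fun i _ => by ring
  have hroot : ∀ b ∈ Z, (q j₀).IsRoot b := by
    intro b hb
    obtain ⟨hb0, hFb⟩ := hZ b hb
    have hFne : ∀ᶠ x in 𝓝[≠] b, F x ≠ 0 := by
      rcases (hF b hb0).eventually_eq_zero_or_eventually_ne_zero with h | h
      · obtain ⟨x, hx, hFx⟩ := hne
        exact absurd (hF.eqOn_zero_of_preconnected_of_eventuallyEq_zero isPreconnected_Ioi
          (Set.mem_Ioi.2 hb0) h hx) hFx
      · exact h
    have hQz : ∀ᶠ x in 𝓝[≠] b, Q x = 0 := by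
      have hpos : ∀ᶠ x in 𝓝[≠] b, 0 < x := nhdsWithin_le_nhds (Ioi_mem_nhds hb0)
      filter_upwards [hFne, hpos] with x hx hx0
      exact (mul_eq_zero.1 (hFQ x hx0)).resolve_left (pow_ne_zero _ hx)
    have hQc : ContinuousAt Q b := by
      have := (hF b hb0).continuousAt
      refine tendsto_finsetSum _ fun j _ => ?_
      exact ((q j).continuous.continuousAt).mul (this.pow _)
    have hQb : Q b = 0 := by
      refine tendsto_nhds_unique (hQc.tendsto.mono_left nhdsWithin_le_nhds : Tendsto Q (𝓝[≠] b) _) ?_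
      exact tendsto_const_nhds.congr' (hQz.mono fun x hx => hx.symm)
    rw [IsRoot, ← hQb, hQ]
    simp only [hFb]
    rw [Finset.sum_eq_single j₀]
    · simp
    · intro j _ hj
      rcases lt_or_gt_of_ne hj with h | h
      · rw [hlow j h, eval_zero, zero_mul]
      · rw [zero_pow (Nat.sub_ne_zero_of_lt h), mul_zero]
    · simp
  have hsub : Z ⊆ (q j₀).roots.toFinset := fun b hb => by
    rw [Multiset.mem_toFinset, mem_roots hj₀]
    exact hroot b hb
  calc Z.card ≤ (q j₀).roots.toFinset.card := Finset.card_le_card hsub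
    _ ≤ Multiset.card (q j₀).roots := Multiset.toFinset_card_le _
    _ ≤ (q j₀).natDegree := card_roots' _
    _ ≤ I := hqdeg j₀

theorem card_zeros_sum_rootProd_le {t n : ℕ} (hn : 0 < n) (a : Fin t → ℝ) (ha : ∀ i, 0 ≤ a i)
    (c : (Fin t → Fin n) → ℝ) (hne : ∃ x, 0 < x ∧ ∑ α, c α * rootProd n a α x ≠ 0)
    (Z : Finset ℝ) (hZ : ∀ x ∈ Z, 0 < x ∧ ∑ α, c α * rootProd n a α x = 0) :
    Z.card ≤ 2 * t * n * n ^ t := by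
  have hpos : ∀ x, 0 < x → ∀ i, 0 < x + a i := fun x hx i => by linarith [ha i]
  obtain ⟨J, l, hl, hrel⟩ := exists_relation (E := Set.Ioi (0 : ℝ) → ℝ) (t := t) (n := n)
    (X := fun x => x) (u := fun i x => ((x : ℝ) + a i) ^ (1 / n : ℝ)) hn (a := a) (by
      intro i
      funext x
      simp only [Pi.pow_apply, Pi.add_apply, Pi.algebraMap_apply, Algebra.algebraMap_self_apply]
      rw [← Real.rpow_natCast, ← Real.rpow_mul (hpos x x.2 i).le, one_div_mul_cancel
        (by exact_mod_cast hn.ne'), Real.rpow_one]) c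
  refine card_zeros_le_of_relation
    (fun x hx => analyticAt_sum_rootProd a c x (hpos x hx)) hne l hl (fun x hx => ?_) Z hZ
  have h1 := congrFun hrel ⟨x, hx⟩
  simp only [Finset.sum_apply, Pi.smul_apply, Pi.mul_apply, Pi.pow_apply, smul_eq_mul,
    Finset.prod_apply, Pi.zero_apply] at h1
  rw [← h1]
  refine Finset.sum_congr rfl fun p _ => ?_
  congr 3
  refine Finset.sum_congr rfl fun α _ => ?_
  congr 1
  refine Finset.prod_congr rfl fun i _ => ?_
  rw [← Real.rpow_natCast, ← Real.rpow_mul (hpos x hx i).le]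
  congr 1
  ring

/-- Uniform polynomial approximation on `|h| ≤ 1 / 2` of a product of fractional powers. -/
theorem exists_poly_approx {t : ℕ} (A β : Fin t → ℝ) (X₀ Y : ℝ) (hX₀ : 0 < X₀) (hY : 1 ≤ Y)
    (hA : ∀ i, X₀ ≤ A i) (hAY : ∀ i, A i + X₀ ≤ Y) (hβ : ∀ i, 0 ≤ β i) (hβ1 : ∀ i, β i ≤ 1)
    (K : ℕ) :
    ∃ v : ℕ → ℝ, (∀ m, |v m| ≤ Y ^ t) ∧ ∀ h : ℝ, |h| ≤ 1 / 2 →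
      |∏ i, (A i + X₀ * h) ^ β i - ∑ m ∈ Finset.range K, v m * (2 * h) ^ m| ≤
        3 * Y ^ t * (2 / 3) ^ K := by
  set f : ℂ → ℂ := fun z => ∏ i, ((A i : ℂ) + X₀ * z) ^ (β i : ℂ) with hf
  have hR : (0:ℝ) ≤ Y ^ t := by positivity
  have hslit : ∀ i, ∀ z ∈ Metric.ball (0 : ℂ) 1, (A i : ℂ) + X₀ * z ∈ Complex.slitPlane := by
    intro i z hz
    left
    have h1 : ‖z‖ < 1 := by simpa using hz
    have h2 : -1 < z.re := by
      have := Complex.abs_re_le_norm z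
      have := neg_abs_le z.re
      linarith
    simp only [Complex.add_re, Complex.ofReal_re, Complex.mul_re, Complex.ofReal_im, zero_mul,
      sub_zero]
    nlinarith [hA i]
  have hdiff : DifferentiableOn ℂ f (Metric.ball 0 1) := by
    refine DifferentiableOn.fun_finsetProd fun i _ => ?_
    exact DifferentiableOn.cpow (by fun_prop) (by fun_prop) fun z hz => hslit i z hz
  have hbound : ∀ z ∈ Metric.ball (0 : ℂ) 1, ‖f z‖ ≤ Y ^ t := by
    intro z hz
    have h1 : ‖z‖ < 1 := by simpa using hz
    rw [hf, norm_prod]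
    calc ∏ i, ‖((A i : ℂ) + X₀ * z) ^ (β i : ℂ)‖ ≤ ∏ _i : Fin t, Y := by
          refine Finset.prod_le_prod (fun i _ => norm_nonneg _) fun i _ => ?_
          rw [Complex.norm_cpow_real]
          have h2 : ‖(A i : ℂ) + X₀ * z‖ ≤ Y := by
            refine (norm_add_le _ _).trans (le_trans ?_ (hAY i))
            rw [norm_mul, Complex.norm_real, Complex.norm_real, Real.norm_eq_abs,
              Real.norm_eq_abs, abs_of_pos hX₀, abs_of_pos (hX₀.trans_le (hA i))]
            nlinarith
          calc _ ≤ Y ^ β i := Real.rpow_le_rpow (norm_nonneg _) h2 (hβ i)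
            _ ≤ Y ^ (1 : ℝ) := Real.rpow_le_rpow_of_exponent_le hY (hβ1 i)
            _ = Y := Real.rpow_one _
      _ = Y ^ t := by simp
  have hcl : Metric.closedBall (0 : ℂ) (3 / 4) ⊆ Metric.ball 0 1 :=
    Metric.closedBall_subset_ball (by norm_num)
  have hcauchy : ∀ m, ‖iteratedDeriv m f 0‖ ≤ m.factorial * Y ^ t / (3 / 4) ^ m := fun m =>
    Complex.norm_iteratedDeriv_le_of_forall_mem_sphere_norm_le m (by norm_num)
      (DifferentiableOn.diffContOnCl (by
        rw [closure_ball _ (by norm_num)]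
        exact hdiff.mono hcl))
      fun z hz => hbound z (hcl (Metric.sphere_subset_closedBall hz))
  set v : ℕ → ℝ := fun m => ((m.factorial : ℂ)⁻¹ * iteratedDeriv m f 0).re / 2 ^ m with hv
  have hvb : ∀ m, |v m| ≤ Y ^ t * (2 / 3) ^ m := by
    intro m
    have hm : (0 : ℝ) < m.factorial := by exact_mod_cast m.factorial_pos
    have h1 : |((m.factorial : ℂ)⁻¹ * iteratedDeriv m f 0).re| ≤ Y ^ t / (3 / 4) ^ m := by
      refine (Complex.abs_re_le_norm _).trans ?_
      rw [norm_mul, norm_inv, Complex.norm_natCast, inv_mul_le_iff₀ hm, ← mul_div_assoc]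
      exact hcauchy m
    rw [hv, abs_div, abs_of_pos (by positivity : (0:ℝ) < 2 ^ m), div_le_iff₀ (by positivity),
      mul_assoc, ← mul_pow]
    refine h1.trans (le_of_eq ?_)
    rw [div_eq_mul_inv, ← inv_pow]
    norm_num
  refine ⟨v, fun m => (hvb m).trans ?_, fun h hh => ?_⟩
  · exact mul_le_of_le_one_right hR (pow_le_one₀ (by norm_num) (by norm_num))
  · have hh' := abs_le.1 hh
    have hmem : (h : ℂ) ∈ Metric.ball (0 : ℂ) 1 := by
      rw [mem_ball_zero_iff, Complex.norm_real, Real.norm_eq_abs]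
      linarith
    have hs := Complex.hasSum_re (Complex.hasSum_taylorSeries_on_ball hdiff hmem)
    have hfh : f h = ((∏ i, (A i + X₀ * h) ^ β i : ℝ) : ℂ) := by
      rw [hf]
      push_cast
      refine Finset.prod_congr rfl fun i _ => ?_
      rw [Complex.ofReal_cpow (by nlinarith [hA i])]
      push_cast
      rfl
    rw [hfh, Complex.ofReal_re] at hs
    have hs' : HasSum (fun m => v m * (2 * h) ^ m) (∏ i, (A i + X₀ * h) ^ β i) := by
      refine hs.congr_fun ?_
      intro m
      have h1 : ((m.factorial : ℂ)⁻¹ • ((h : ℂ) - 0) ^ m • iteratedDeriv m f 0) =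
          ((h ^ m : ℝ) : ℂ) * ((m.factorial : ℂ)⁻¹ * iteratedDeriv m f 0) := by
        simp only [smul_eq_mul, sub_zero]
        push_cast
        ring
      rw [h1, Complex.re_ofReal_mul, hv, mul_pow]
      field_simp
    have htail := (hasSum_nat_add_iff' K).2 hs'
    have hg : HasSum (fun m : ℕ => Y ^ t * (2 / 3) ^ K * (2 / 3 : ℝ) ^ m)
        (Y ^ t * (2 / 3) ^ K * (1 - 2 / 3)⁻¹) :=
      (hasSum_geometric_of_lt_one (by norm_num) (by norm_num)).mul_left _
    have h2 : ∀ m, ‖v (m + K) * (2 * h) ^ (m + K)‖ ≤ Y ^ t * (2 / 3) ^ K * (2 / 3 : ℝ) ^ m := by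
      intro m
      rw [norm_mul, norm_pow, Real.norm_eq_abs, Real.norm_eq_abs]
      have h3 : |2 * h| ^ (m + K) ≤ 1 := by
        refine pow_le_one₀ (abs_nonneg _) ?_
        rw [abs_mul, abs_two]; linarith
      calc |v (m + K)| * |2 * h| ^ (m + K) ≤ |v (m + K)| * 1 :=
            mul_le_mul_of_nonneg_left h3 (abs_nonneg _)
        _ ≤ Y ^ t * (2 / 3) ^ (m + K) := by rw [mul_one]; exact hvb _
        _ = _ := by rw [pow_add]; ring
    have h3 := tsum_of_norm_bounded hg h2
    rw [htail.tsum_eq, Real.norm_eq_abs] at h3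
    refine h3.trans (le_of_eq ?_)
    norm_num
    ring

/-- Pigeonhole: many bounded vectors have a small nontrivial integral combination. -/
theorem exists_int_comb_small {ι : Type*} [Fintype ι] (K R : ℕ) (hK : 0 < K) (hR : 0 < R)
    (hk : 2 * K ≤ Fintype.card ι) (v : ι → ℕ → ℝ) (hv : ∀ i m, |v i m| ≤ R) :
    ∃ c : ι → ℤ, c ≠ 0 ∧ (∀ i, |c i| ≤ 4 * K * Fintype.card ι * R) ∧
      ∀ m < K, |∑ i, (c i : ℝ) * v i m| < 1 / (2 * K) := by
  classical
  set k := Fintype.card ι with hkdef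
  set C := 4 * K * k * R with hC
  set B : ℤ := 2 * K * (k * C * R) with hB
  have hK' : (0 : ℝ) < 2 * K := by positivity
  set S : (ι → Fin (C + 1)) → ℕ → ℝ := fun c m => ∑ i, ((c i : ℕ) : ℝ) * v i m with hS
  have hSb : ∀ c m, |S c m| ≤ k * C * R := by
    intro c m
    refine (Finset.abs_sum_le_sum_abs _ _).trans ?_
    have : ∀ i ∈ Finset.univ, |((c i : ℕ) : ℝ) * v i m| ≤ C * R := by
      intro i _
      rw [abs_mul, Nat.abs_cast]
      exact mul_le_mul (by exact_mod_cast Nat.le_of_lt_succ (c i).2) (hv i m) (abs_nonneg _)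
        (Nat.cast_nonneg _)
    refine (Finset.sum_le_card_nsmul _ _ _ this).trans (le_of_eq ?_)
    rw [nsmul_eq_mul, Finset.card_univ, mul_assoc]
  have hmaps : Set.MapsTo (fun (c : ι → Fin (C + 1)) (m : Fin K) => ⌊2 * K * S c m⌋)
      (Finset.univ : Finset (ι → Fin (C + 1)))
      (Fintype.piFinset fun _ : Fin K => Finset.Icc (-B) B : Finset (Fin K → ℤ)) := by
    intro c _
    simp only [Finset.mem_coe, Fintype.mem_piFinset, Finset.mem_Icc]
    intro m
    have h1 := abs_le.1 (hSb c m)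
    have h2 : ((B : ℤ) : ℝ) = 2 * K * (k * C * R) := by rw [hB]; push_cast; ring
    constructor
    · rw [Int.le_floor]
      push_cast
      rw [h2]
      nlinarith [mul_le_mul_of_nonneg_left h1.1 hK'.le]
    · have h3 : (⌊2 * K * S c m⌋ : ℝ) ≤ B := by
        refine (Int.floor_le _).trans ?_
        rw [h2]
        exact mul_le_mul_of_nonneg_left h1.2 hK'.le
      exact_mod_cast h3
  have hcard : (Fintype.piFinset fun _ : Fin K => Finset.Icc (-B) B : Finset (Fin K → ℤ)).card <
      (Finset.univ : Finset (ι → Fin (C + 1))).card := by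
    rw [Fintype.card_piFinset_const, Finset.card_univ, Fintype.card_fun, Fintype.card_fin,
      Int.card_Icc, ← hkdef]
    have h1 : (B + 1 - -B).toNat = C * C + 1 := by
      have : B + 1 - -B = ((C * C + 1 : ℕ) : ℤ) := by
        rw [hB, hC]; push_cast; ring
      rw [this, Int.toNat_natCast]
    have hC0 : 0 < C := by
      have : 0 < k := by omega
      positivity
    calc (B + 1 - -B).toNat ^ K = (C * C + 1) ^ K := by rw [h1]
      _ < ((C + 1) ^ 2) ^ K := Nat.pow_lt_pow_left (by nlinarith) hK.ne'
      _ = (C + 1) ^ (2 * K) := by rw [pow_mul]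
      _ ≤ (C + 1) ^ k := Nat.pow_le_pow_right (by omega) hk
  obtain ⟨c, -, c', -, hne, heq⟩ :=
    Finset.exists_ne_map_eq_of_card_lt_of_maps_to hcard hmaps
  refine ⟨fun i => ((c i : ℕ) : ℤ) - ((c' i : ℕ) : ℤ), ?_, ?_, ?_⟩
  · intro h0
    apply hne
    funext i
    have := congrFun h0 i
    simp only [Pi.zero_apply] at this
    exact Fin.ext (by omega)
  · intro i
    have h1 := (c i).2
    have h2 := (c' i).2
    have h3 : ((4 : ℤ) * K * k * R) = (C : ℕ) := by rw [hC]; push_cast; ring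
    rw [h3, abs_le]
    dsimp only
    constructor <;> omega
  · intro m hm
    have h1 := Int.abs_sub_lt_one_of_floor_eq_floor (congrFun heq ⟨m, hm⟩)
    simp only at h1
    have h2 : ∑ i, (((((c i : ℕ) : ℤ) - ((c' i : ℕ) : ℤ) : ℤ)) : ℝ) * v i m = S c m - S c' m := by
      simp only [hS]
      rw [← Finset.sum_sub_distrib]
      refine Finset.sum_congr rfl fun i _ => ?_
      push_cast
      ring
    rw [h2, lt_div_iff₀ hK']
    rw [← mul_sub, abs_mul, abs_of_pos hK'] at h1
    linarith

theorem exists_int_comb_rootProd_lt_one {t n : ℕ} (a : Fin t → ℝ) (ha : ∀ i, 0 ≤ a i)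
    (X₀ : ℝ) (hX₀ : 0 < X₀) (Y K : ℕ) (hY : 0 < Y) (hK : 0 < K) (haY : ∀ i, 2 * X₀ + a i ≤ Y)
    (hk : 2 * K ≤ n ^ t)
    (htail : 24 * K * (n ^ t) ^ 2 * (Y ^ t) ^ 2 * 2 ^ K ≤ 3 ^ K) :
    ∃ c : (Fin t → Fin n) → ℤ, c ≠ 0 ∧ ∀ x, X₀ / 2 ≤ x → x ≤ X₀ →
      |∑ α, (c α : ℝ) * rootProd n a α x| < 1 := by
  classical
  have hYt : 0 < Y ^ t := pow_pos hY t
  have happ := fun α : Fin t → Fin n => exists_poly_approx (fun i => X₀ + a i)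
    (fun i => ((α i : ℕ) : ℝ) / n) X₀ Y hX₀ (by exact_mod_cast hY)
    (fun i => by linarith [ha i]) (fun i => by linarith [haY i]) (fun i => by positivity)
    (fun i => div_le_one_of_le₀ (by exact_mod_cast (α i).2.le) (by positivity)) K
  choose v hv1 hv2 using happ
  obtain ⟨c, hc0, hcb, hcs⟩ := exists_int_comb_small K (Y ^ t) hK hYt (by simpa using hk) v
    (fun α m => by exact_mod_cast hv1 α m)
  refine ⟨c, hc0, fun x hx1 hx2 => ?_⟩
  set h := (x - X₀) / X₀ with hh
  have hXh : X₀ * h = x - X₀ := by rw [hh]; field_simp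
  have hhb : |h| ≤ 1 / 2 := by
    rw [hh, abs_div, abs_of_pos hX₀, div_le_iff₀ hX₀, abs_le]
    constructor <;> linarith
  have hrp : ∀ α, rootProd n a α x = ∏ i, (X₀ + a i + X₀ * h) ^ (((α i : ℕ) : ℝ) / n) := by
    intro α
    refine Finset.prod_congr rfl fun i _ => ?_
    rw [hXh]; congr 1; ring
  have hsplit : ∑ α, (c α : ℝ) * rootProd n a α x =
      (∑ α, (c α : ℝ) * (rootProd n a α x - ∑ m ∈ Finset.range K, v α m * (2 * h) ^ m)) +
      ∑ m ∈ Finset.range K, (∑ α, (c α : ℝ) * v α m) * (2 * h) ^ m := by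
    have : ∑ m ∈ Finset.range K, (∑ α, (c α : ℝ) * v α m) * (2 * h) ^ m =
        ∑ α, (c α : ℝ) * ∑ m ∈ Finset.range K, v α m * (2 * h) ^ m := by
      simp only [Finset.sum_mul, Finset.mul_sum]
      rw [Finset.sum_comm]
      exact Finset.sum_congr rfl fun α _ => Finset.sum_congr rfl fun m _ => by ring
    rw [this, ← Finset.sum_add_distrib]
    exact Finset.sum_congr rfl fun α _ => by ring
  have hK' : (0 : ℝ) < K := by exact_mod_cast hK
  have hmain : |∑ m ∈ Finset.range K, (∑ α, (c α : ℝ) * v α m) * (2 * h) ^ m| < 1 / 2 := by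
    refine (Finset.abs_sum_le_sum_abs _ _).trans_lt ?_
    have h1 : ∀ m ∈ Finset.range K,
        |(∑ α, (c α : ℝ) * v α m) * (2 * h) ^ m| < 1 / (2 * K) := by
      intro m hm
      rw [abs_mul, abs_pow]
      refine lt_of_le_of_lt (mul_le_of_le_one_right (abs_nonneg _)
        (pow_le_one₀ (abs_nonneg _) ?_)) (hcs m (Finset.mem_range.1 hm))
      rw [abs_mul, abs_two]; linarith
    refine (Finset.sum_lt_sum_of_nonempty (by simpa using hK.ne') h1).trans_le (le_of_eq ?_)
    rw [Finset.sum_const, Finset.card_range, nsmul_eq_mul]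
    field_simp
  have herr : |∑ α, (c α : ℝ) * (rootProd n a α x - ∑ m ∈ Finset.range K, v α m * (2 * h) ^ m)|
      ≤ 1 / 2 := by
    have h1 : ∀ α ∈ (Finset.univ : Finset (Fin t → Fin n)),
        |(c α : ℝ) * (rootProd n a α x - ∑ m ∈ Finset.range K, v α m * (2 * h) ^ m)| ≤
        (4 * K * (n ^ t : ℕ) * (Y ^ t : ℕ)) * (3 * (Y : ℝ) ^ t * (2 / 3) ^ K) := by
      intro α _
      rw [abs_mul, hrp]
      refine mul_le_mul ?_ (hv2 α h hhb) (abs_nonneg _) (by positivity)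
      have := hcb α
      rw [Fintype.card_fun, Fintype.card_fin, Fintype.card_fin] at this
      exact_mod_cast this
    refine (Finset.abs_sum_le_sum_abs _ _).trans
      ((Finset.sum_le_card_nsmul _ _ _ h1).trans ?_)
    rw [Finset.card_univ, Fintype.card_fun, Fintype.card_fin, Fintype.card_fin, nsmul_eq_mul]
    have h2 : (24 * K * (n ^ t) ^ 2 * (Y ^ t) ^ 2 * 2 ^ K : ℝ) ≤ 3 ^ K := by exact_mod_cast htail
    have h3 : (0 : ℝ) < 3 ^ K := by positivity
    have h4 : ((n ^ t : ℕ) : ℝ) * (4 * K * (n ^ t : ℕ) * (Y ^ t : ℕ) *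
        (3 * (Y : ℝ) ^ t * (2 / 3) ^ K)) =
        (24 * K * (n ^ t) ^ 2 * (Y ^ t) ^ 2 * 2 ^ K) / 3 ^ K / 2 := by
      rw [div_pow]; push_cast; ring
    rw [h4]
    have := (div_le_one h3).2 h2
    linarith
  rw [hsplit]
  exact (abs_add_le _ _).trans_lt (by linarith)

theorem rootProd_eq_natCast {t n : ℕ} (hn : 0 < n) (a : Fin t → ℕ) (b : ℕ) (r : Fin t → ℕ)
    (h : ∀ i, b + a i = r i ^ n) (α : Fin t → Fin n) :
    rootProd n (fun i => (a i : ℝ)) α b = ((∏ i, r i ^ (α i : ℕ) : ℕ) : ℝ) := by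
  unfold rootProd
  push_cast
  refine Finset.prod_congr rfl fun i _ => ?_
  have h1 : (b : ℝ) + a i = (r i : ℝ) ^ n := by exact_mod_cast h i
  rw [h1, ← Real.rpow_natCast, ← Real.rpow_natCast, ← Real.rpow_mul (Nat.cast_nonneg _),
    mul_div_cancel₀ _ (by exact_mod_cast hn.ne')]

open Filter in
theorem card_dyadic_common_le {t n L N : ℕ} (hn : 2 ≤ n) (hN : N < 2 ^ L) (hL2 : 2 ≤ L)
    (htl : L ^ 3 ≤ n ^ t) (htu : n ^ t ≤ L ^ 4)
    (hL : 24 * L ^ (8 * L + 34) * 2 ^ (L ^ 2) ≤ 3 ^ (L ^ 2))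
    (a : Fin t → ℕ) (ha : StrictMono a) (B : Finset ℕ) (j : ℕ) (hj : j < L)
    (hBj : ∀ b ∈ B, 2 ^ j ≤ b ∧ b < 2 ^ (j + 1))
    (h : ∀ b ∈ B, ∀ i, (∃ r, b + a i = r ^ n) ∧ b + a i ≤ N) :
    B.card ≤ 2 * t * n * n ^ t := by
  rcases B.eq_empty_or_nonempty with rfl | ⟨b₀, hb₀⟩
  · simp
  have hn0 : 0 < n := by omega
  have haN : ∀ i, a i ≤ 2 ^ L := fun i => by have := (h b₀ hb₀ i).2; omega
  have h2t : 2 ^ t ≤ L ^ 4 := (Nat.pow_le_pow_left hn t).trans htu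
  obtain ⟨c, hc0, hc⟩ := exists_int_comb_rootProd_lt_one (n := n) (fun i => (a i : ℝ))
    (fun i => Nat.cast_nonneg _) (2 ^ (j + 1)) (by positivity) (2 ^ (L + 3)) (L ^ 2)
    (by positivity) (by positivity) (by
      intro i
      have h1 : 2 ^ (j + 1) ≤ 2 ^ L := Nat.pow_le_pow_right (by norm_num) hj
      have h2 : 2 * 2 ^ (j + 1) + a i ≤ 2 ^ (L + 3) := by
        have := haN i
        rw [pow_add 2 L 3]
        omega
      exact_mod_cast h2) (by
      refine le_trans ?_ htl
      rw [pow_succ, mul_comm]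
      exact Nat.mul_le_mul_left _ hL2) (by
      refine le_trans ?_ hL
      have h1 : ((2 ^ (L + 3)) ^ t) ^ 2 ≤ L ^ (8 * L + 24) := by
        calc ((2 ^ (L + 3)) ^ t) ^ 2 = (2 ^ t) ^ (2 * (L + 3)) := by
              rw [← pow_mul, ← pow_mul, ← pow_mul]; congr 1; ring
          _ ≤ (L ^ 4) ^ (2 * (L + 3)) := Nat.pow_le_pow_left h2t _
          _ = L ^ (8 * L + 24) := by rw [← pow_mul]; congr 1; ring
      calc 24 * L ^ 2 * (n ^ t) ^ 2 * ((2 ^ (L + 3)) ^ t) ^ 2 * 2 ^ L ^ 2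
          ≤ 24 * L ^ 2 * (L ^ 4) ^ 2 * L ^ (8 * L + 24) * 2 ^ L ^ 2 := by gcongr
        _ = 24 * L ^ (8 * L + 34) * 2 ^ L ^ 2 := by
            rw [show 8 * L + 34 = 2 + 4 * 2 + (8 * L + 24) by ring, pow_add, pow_add, pow_mul]
            ring)
  have hne : ∃ x, 0 < x ∧ ∑ α, (c α : ℝ) * rootProd n (fun i => (a i : ℝ)) α x ≠ 0 := by
    by_contra! hall
    apply hc0
    funext α
    have := rootProd_linearIndependent hn0 t (fun i => (a i : ℝ))
      (fun i j hij => Nat.cast_lt.2 (ha hij)) (fun α => (c α : ℝ)) (by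
        filter_upwards [eventually_gt_atTop 0] with x hx
        exact hall x hx) α
    exact_mod_cast this
  have hz := card_zeros_sum_rootProd_le hn0 (fun i => (a i : ℝ)) (fun i => Nat.cast_nonneg _)
    (fun α => (c α : ℝ)) hne (B.image (fun b : ℕ => (b : ℝ))) (by
      intro x hx
      obtain ⟨b, hb, rfl⟩ := Finset.mem_image.1 hx
      obtain ⟨h1, h2⟩ := hBj b hb
      have hb0 : 0 < b := lt_of_lt_of_le (by positivity) h1
      refine ⟨by exact_mod_cast hb0, ?_⟩
      choose r hr using fun i => (h b hb i).1
      have h3 := hc b (by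
        rw [pow_succ, mul_div_cancel_right₀ _ (by norm_num)]
        exact_mod_cast h1) (by exact_mod_cast h2.le)
      have h4 : ∑ α, (c α : ℝ) * rootProd n (fun i => (a i : ℝ)) α b =
          ((∑ α, c α * ((∏ i, r i ^ (α i : ℕ) : ℕ) : ℤ) : ℤ) : ℝ) := by
        rw [Int.cast_sum]
        refine Finset.sum_congr rfl fun α _ => ?_
        rw [rootProd_eq_natCast hn0 a b r hr α]
        push_cast
        ring
      rw [h4] at h3 ⊢
      have h5 : |∑ α, c α * ((∏ i, r i ^ (α i : ℕ) : ℕ) : ℤ)| < 1 := by exact_mod_cast h3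
      exact_mod_cast Int.abs_lt_one_iff.1 h5)
  rwa [Finset.card_image_of_injective _ Nat.cast_injective] at hz

/-- Few integers `b` are such that all `b + a i` are `n`-th powers. -/
theorem card_common_le {t n L N : ℕ} (hn : 2 ≤ n) (hN : N < 2 ^ L) (hL2 : 2 ≤ L)
    (htl : L ^ 3 ≤ n ^ t) (htu : n ^ t ≤ L ^ 4)
    (hL : 24 * L ^ (8 * L + 34) * 2 ^ (L ^ 2) ≤ 3 ^ (L ^ 2))
    (a : Fin t → ℕ) (ha : Function.Injective a) (B : Finset ℕ) (hB : ∀ b ∈ B, 0 < b)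
    (h : ∀ b ∈ B, ∀ i, (∃ r, b + a i = r ^ n) ∧ b + a i ≤ N) :
    B.card ≤ 2 * t * n * n ^ t * L := by
  classical
  have ht : 0 < t := by
    rcases Nat.eq_zero_or_pos t with rfl | ht
    · have : 1 < L ^ 3 := Nat.one_lt_pow (by norm_num) hL2
      simp at htl
      omega
    · exact ht
  have hcard : (Finset.univ.image a).card = t := by
    rw [Finset.card_image_of_injective _ ha, Finset.card_univ, Fintype.card_fin]
  set a' := (Finset.univ.image a).orderEmbOfFin hcard with ha'
  have hmem : ∀ i, ∃ k, a k = a' i := fun i => by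
    have := Finset.orderEmbOfFin_mem (Finset.univ.image a) hcard i
    obtain ⟨k, -, hk⟩ := Finset.mem_image.1 this
    exact ⟨k, hk⟩
  have himg : (B.image (Nat.log 2)).card ≤ L := by
    have : B.image (Nat.log 2) ⊆ Finset.range L := by
      intro j hj
      obtain ⟨b, hb, rfl⟩ := Finset.mem_image.1 hj
      have h1 := (h b hb ⟨0, ht⟩).2
      exact Finset.mem_range.2 (Nat.log_lt_of_lt_pow (hB b hb).ne' (by omega))
    simpa using Finset.card_le_card this
  refine (Finset.card_le_mul_card_image B (2 * t * n * n ^ t) fun j hj => ?_).trans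
    (Nat.mul_le_mul_left _ himg)
  obtain ⟨b, hb, rfl⟩ := Finset.mem_image.1 hj
  refine card_dyadic_common_le hn hN hL2 htl htu hL a' a'.strictMono _ (Nat.log 2 b) ?_ ?_ ?_
  · have h1 := (h b hb ⟨0, ht⟩).2
    exact Nat.log_lt_of_lt_pow (hB b hb).ne' (by omega)
  · intro b' hb'
    obtain ⟨h1, h2⟩ := Finset.mem_filter.1 hb'
    rw [← h2]
    exact ⟨Nat.pow_log_le_self 2 (hB b' h1).ne', Nat.lt_pow_succ_log_self (by norm_num) _⟩
  · intro b' hb' i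
    obtain ⟨k, hk⟩ := hmem i
    rw [← hk]
    exact h b' (Finset.mem_filter.1 hb').1 k

theorem descFactorial_le_card_injective (S : Finset ℕ) (t : ℕ) :
    S.card.descFactorial t ≤
      ((Fintype.piFinset fun _ : Fin t => S).filter Function.Injective).card := by
  classical
  have h1 : Fintype.card (Fin t ↪ S) = S.card.descFactorial t := by
    rw [Fintype.card_embedding_eq, Fintype.card_fin, Fintype.card_coe]
  rw [← h1, ← Finset.card_univ]
  refine Finset.card_le_card_of_injOn (fun e i => (e i : ℕ)) ?_ ?_
  · intro e _
    simp only [Finset.coe_filter, Fintype.mem_piFinset, Set.mem_ofPred_eq]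
    exact ⟨fun i => (e i).2, fun i j hij => e.injective (Subtype.ext hij)⟩
  · intro e _ e' _ h
    ext i
    exact congrFun h i

open Classical in
/-- Some exponent is used by a proportion at least `1 / n ^ 2` of the sums. -/
theorem exists_popular_exponent {L N : ℕ} (hN : N < 2 ^ L) (A : Finset ℕ) (hA : A.Nonempty)
    (b : ℕ) (hb : 0 < b) (hA0 : ∀ x ∈ A, 0 < x) (h : ∀ x ∈ A, IsPurePower (b + x) ∧ b + x ≤ N) :
    ∃ n, 2 ≤ n ∧ n < L ∧
      A.card ≤ (A.filter fun x => ∃ r, b + x = r ^ n).card * n ^ 2 := by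
  classical
  by_contra! hno
  have hsub : A ⊆ (Finset.Ico 2 (L + 3)).biUnion
      (fun n => if n < L then A.filter fun x => ∃ r, b + x = r ^ n else ∅) := by
    intro x hx
    obtain ⟨⟨r, n, hr, hn, he⟩, hle⟩ := h x hx
    have hr2 : 2 ≤ r := by
      by_contra hlt
      have : r = 1 := by omega
      rw [this, one_pow] at he
      have := hA0 x hx
      omega
    have hnL : n < L := by
      have h1 : 2 ^ n ≤ r ^ n := Nat.pow_le_pow_left hr2 n
      exact (Nat.pow_lt_pow_iff_right (by norm_num)).1 (lt_of_le_of_lt h1 (by omega))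
    refine Finset.mem_biUnion.2 ⟨n, Finset.mem_Ico.2 ⟨hn, by omega⟩, ?_⟩
    rw [if_pos hnL]
    exact Finset.mem_filter.2 ⟨hx, r, he⟩
  have h1 : (A.card : ℝ) ≤ ∑ n ∈ Finset.Ico 2 (L + 3), (A.card : ℝ) / (n * n) := by
    refine (Nat.cast_le.2 ((Finset.card_le_card hsub).trans Finset.card_biUnion_le)).trans ?_
    push_cast
    refine Finset.sum_le_sum fun n hn => ?_
    have hn2 := (Finset.mem_Ico.1 hn).1
    have hn0 : (0 : ℝ) < n := by exact_mod_cast (by omega : 0 < n)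
    split_ifs with hnL
    · rw [le_div_iff₀ (by positivity)]
      have := hno n hn2 hnL
      rw [pow_two] at this
      exact_mod_cast this.le
    · rw [Finset.card_empty, Nat.cast_zero]
      positivity
  have h2 := h1.trans (sum_div_sq_le A.card L)
  have h3 : (0 : ℝ) < A.card := by exact_mod_cast hA.card_pos
  have h4 : (0 : ℝ) < 1 / ((L : ℝ) + 2) := by positivity
  nlinarith

theorem exists_pow_mem_Icc {n L : ℕ} (hn : 2 ≤ n) (hnL : n ≤ L) :
    ∃ t, L ^ 3 ≤ n ^ t ∧ n ^ t ≤ L ^ 4 := by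
  refine ⟨Nat.clog n (L ^ 3), Nat.le_pow_clog (by omega) _, ?_⟩
  have h1 : 1 < L ^ 3 := Nat.one_lt_pow (by norm_num) (by omega)
  have h2 := Nat.pow_pred_clog_lt_self (b := n) (by omega) h1
  have h3 := Nat.clog_pos (b := n) (by omega) h1
  calc n ^ Nat.clog n (L ^ 3) = n ^ (Nat.clog n (L ^ 3) - 1) * n := by
        rw [← pow_succ]; congr 1; omega
    _ ≤ L ^ 3 * L := Nat.mul_le_mul h2.le hnL
    _ = L ^ 4 := by ring

/-- If all sums `a + b` are pure powers, one of the two sets is small. -/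
theorem card_le_of_bipartite {L N : ℕ} (hN : N < 2 ^ L) (hL2 : 2 ≤ L)
    (hL : 24 * L ^ (8 * L + 34) * 2 ^ (L ^ 2) ≤ 3 ^ (L ^ 2)) (A B : Finset ℕ)
    (hA : ∀ x ∈ A, 0 < x) (hB : ∀ x ∈ B, 0 < x)
    (h : ∀ b ∈ B, ∀ x ∈ A, IsPurePower (b + x) ∧ b + x ≤ N) (hcard : L ^ 7 ≤ A.card) :
    B.card ≤ L ^ 24 := by
  classical
  have hAne : A.Nonempty := Finset.card_pos.1 (lt_of_lt_of_le (by positivity) hcard)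
  have hex : ∀ b : ℕ, ∃ n, b ∈ B → 2 ≤ n ∧ n < L ∧
      A.card ≤ (A.filter fun x => ∃ r, b + x = r ^ n).card * n ^ 2 := by
    intro b
    by_cases hb : b ∈ B
    · obtain ⟨n, hn⟩ := exists_popular_exponent hN A hAne b (hB b hb) hA (h b hb)
      exact ⟨n, fun _ => hn⟩
    · exact ⟨0, fun hb' => absurd hb' hb⟩
  choose e he using hex
  have himg : (B.image e).card ≤ L := by
    have : B.image e ⊆ Finset.range L := by
      intro j hj
      obtain ⟨b, hb, rfl⟩ := Finset.mem_image.1 hj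
      exact Finset.mem_range.2 (he b hb).2.1
    simpa using Finset.card_le_card this
  have hfib : ∀ n ∈ B.image e, (B.filter fun b => e b = n).card ≤ 2 * L ^ 22 := by
    intro n hn
    obtain ⟨hn2, hnL⟩ : 2 ≤ n ∧ n < L := by
      obtain ⟨b, hb, rfl⟩ := Finset.mem_image.1 hn
      exact ⟨(he b hb).1, (he b hb).2.1⟩
    obtain ⟨t, htl, htu⟩ := exists_pow_mem_Icc hn2 hnL.le
    have htL : t ≤ L ^ 4 := (Nat.lt_two_pow_self.le.trans (Nat.pow_le_pow_left hn2 t)).trans htu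
    set Bn := B.filter fun b => e b = n with hBn
    have hmemB : ∀ b ∈ Bn, b ∈ B := fun b hb => (Finset.mem_filter.1 hb).1
    set S : ℕ → Finset ℕ := fun b => A.filter fun x => ∃ r, b + x = r ^ n with hS
    set T := (Fintype.piFinset fun _ : Fin t => A).filter Function.Injective with hT
    have hm0 : 0 < A.card := hAne.card_pos
    obtain ⟨q, hq1, hq2⟩ : ∃ q, A.card ≤ 2 * n ^ 2 * q ∧
        ∀ z, A.card ≤ 2 * n ^ 2 * z → q ≤ z := by
      have hex : ∃ q, A.card ≤ 2 * n ^ 2 * q :=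
        ⟨A.card, Nat.le_mul_of_pos_left _ (by positivity)⟩
      exact ⟨Nat.find hex, Nat.find_spec hex, fun z hz => Nat.find_min' hex hz⟩
    have htm : 2 * n ^ 2 * t ≤ A.card := by
      refine le_trans ?_ hcard
      calc 2 * n ^ 2 * t ≤ L * L ^ 2 * L ^ 4 := by gcongr
        _ = L ^ 7 := by ring
    have hdc : Bn.card * q ^ t ≤ T.card * (2 * t * n * n ^ t * L) := by
      refine Finset.card_mul_le_card_mul (fun b f => ∀ i, f i ∈ S b) ?_ ?_
      · intro b hb
        have hs : A.card ≤ (S b).card * n ^ 2 := by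
          have := (he b (hmemB b hb)).2.2
          rwa [(Finset.mem_filter.1 hb).2] at this
        have hqs : q ≤ (S b).card + 1 - t := by
          refine hq2 _ ?_
          have h1 : t ≤ (S b).card := by
            have h2 : n ^ 2 * t ≤ n ^ 2 * (S b).card := by nlinarith
            exact Nat.le_of_mul_le_mul_left h2 (by positivity)
          obtain ⟨z, hz⟩ := Nat.exists_eq_add_of_le h1
          rw [show (S b).card + 1 - t = z + 1 by omega]
          rw [hz] at hs
          nlinarith
        calc q ^ t ≤ ((S b).card + 1 - t) ^ t := Nat.pow_le_pow_left hqs t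
          _ ≤ (S b).card.descFactorial t := Nat.pow_sub_le_descFactorial _ _
          _ ≤ _ := descFactorial_le_card_injective _ _
          _ ≤ _ := by
            refine Finset.card_le_card fun f hf => ?_
            obtain ⟨hf1, hf2⟩ := Finset.mem_filter.1 hf
            rw [Fintype.mem_piFinset] at hf1
            refine (Finset.mem_bipartiteAbove _).2 ?_
            refine ⟨Finset.mem_filter.2 ⟨?_, hf2⟩, hf1⟩
            rw [Fintype.mem_piFinset]
            exact fun i => (Finset.mem_filter.1 (hf1 i)).1
      · intro f hf
        obtain ⟨hf1, hf2⟩ := Finset.mem_filter.1 hf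
        rw [Fintype.mem_piFinset] at hf1
        refine card_common_le hn2 hN hL2 htl htu hL f hf2 _ ?_ ?_
        · intro b hb
          exact hB b (hmemB b ((Finset.mem_bipartiteBelow _).1 hb).1)
        · intro b hb i
          obtain ⟨hb1, hb2⟩ := (Finset.mem_bipartiteBelow _).1 hb
          exact ⟨(Finset.mem_filter.1 (hb2 i)).2, (h b (hmemB b hb1) _ (hf1 i)).2⟩
    have hTcard : T.card ≤ A.card ^ t := by
      refine (Finset.card_filter_le _ _).trans ?_
      rw [Fintype.card_piFinset_const]
    have h1 : Bn.card * A.card ^ t ≤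
        ((2 * n ^ 2) ^ t * (2 * t * n * n ^ t * L)) * A.card ^ t := by
      calc Bn.card * A.card ^ t ≤ Bn.card * (2 * n ^ 2 * q) ^ t := by gcongr
        _ = (2 * n ^ 2) ^ t * (Bn.card * q ^ t) := by rw [mul_pow]; ring
        _ ≤ (2 * n ^ 2) ^ t * (A.card ^ t * (2 * t * n * n ^ t * L)) := by
            exact Nat.mul_le_mul_left _ (hdc.trans (Nat.mul_le_mul_right _ hTcard))
        _ = _ := by ring
    have h2 := Nat.le_of_mul_le_mul_right h1 (by positivity)
    calc Bn.card ≤ (2 * n ^ 2) ^ t * (2 * t * n * n ^ t * L) := h2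
      _ ≤ (L ^ 4) ^ 3 * (2 * L ^ 4 * L * L ^ 4 * L) := by
          have h3 : (2 * n ^ 2) ^ t ≤ (L ^ 4) ^ 3 := by
            calc (2 * n ^ 2) ^ t ≤ (n ^ 3) ^ t := by
                  gcongr
                  rw [pow_succ n 2, mul_comm]
                  exact Nat.mul_le_mul_left _ hn2
              _ = (n ^ t) ^ 3 := by rw [← pow_mul, ← pow_mul, mul_comm]
              _ ≤ _ := Nat.pow_le_pow_left htu 3
          gcongr
      _ = 2 * L ^ 22 := by ring
  calc B.card ≤ 2 * L ^ 22 * (B.image e).card := Finset.card_le_mul_card_image B _ hfib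
    _ ≤ L * L ^ 22 * L := by gcongr
    _ = L ^ 24 := by ring

open Filter in
theorem eventually_pow_le_pow_sq :
    ∀ᶠ L : ℕ in atTop, 24 * L ^ (8 * L + 34) * 2 ^ (L ^ 2) ≤ 3 ^ (L ^ 2) := by
  have h1 : ∀ᶠ L : ℕ in atTop, ‖Real.log (L : ℝ)‖ ≤ 1 / 36 * ‖id (L : ℝ)‖ :=
    tendsto_natCast_atTop_atTop.eventually
      (Real.isLittleO_log_id_atTop.def (by norm_num : (0 : ℝ) < 1 / 36))
  filter_upwards [h1, eventually_ge_atTop 34] with L hL hL34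
  have hL' : (34 : ℝ) ≤ L := by exact_mod_cast hL34
  have hL0 : (0 : ℝ) < L := by linarith
  have hlog0 : 0 ≤ Real.log L := Real.log_nonneg (by linarith)
  rw [id, Real.norm_eq_abs, Real.norm_eq_abs, abs_of_nonneg hlog0, abs_of_pos hL0] at hL
  have h24 : Real.log 24 ≤ 24 - 1 := Real.log_le_sub_one_of_pos (by norm_num)
  have h32 : 1 - (3 / 2 : ℝ)⁻¹ ≤ Real.log (3 / 2) :=
    Real.one_sub_inv_le_log_of_pos (by norm_num)
  rw [Real.log_div (by norm_num) (by norm_num)] at h32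
  have hreal : (24 * (L : ℝ) ^ (8 * L + 34) * 2 ^ (L ^ 2)) ≤ 3 ^ (L ^ 2) := by
    rw [← Real.log_le_log_iff (by positivity) (by positivity),
      Real.log_mul (by positivity) (by positivity), Real.log_mul (by positivity) (by positivity),
      Real.log_pow, Real.log_pow, Real.log_pow]
    push_cast
    have h2 : (8 * (L : ℝ) + 34) * Real.log L ≤ (9 * L) * (1 / 36 * L) :=
      mul_le_mul (by linarith) hL hlog0 (by positivity)
    have h3 : (L : ℝ) ^ 2 * (1 / 3) ≤ (L : ℝ) ^ 2 * (Real.log 3 - Real.log 2) :=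
      mul_le_mul_of_nonneg_left (by norm_num at h32 ⊢; linarith) (by positivity)
    nlinarith
  exact_mod_cast hreal

/-- The set of nonempty subset sums over `H`. -/
def subsetSums {ι : Type*} [DecidableEq ι] (a : ι → ℕ) (H : Finset ι) : Finset ℕ :=
  (H.powerset.filter Finset.Nonempty).image fun s => ∑ i ∈ s, a i

theorem mem_subsetSums {ι : Type*} [DecidableEq ι] {a : ι → ℕ} {H : Finset ι} {x : ℕ} :
    x ∈ subsetSums a H ↔ ∃ s ⊆ H, s.Nonempty ∧ ∑ i ∈ s, a i = x := by
  simp [subsetSums, and_assoc]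

theorem exists_half_few_subset_sums {L N d : ℕ} (hN : N < 2 ^ L) (hL2 : 2 ≤ L)
    (hL : 24 * L ^ (8 * L + 34) * 2 ^ (L ^ 2) ≤ 3 ^ (L ^ 2)) (a : Fin d → ℕ)
    (ha : ∀ i, 0 < a i)
    (h : ∀ F : Finset (Fin d), F.Nonempty →
      IsPurePower (∑ i ∈ F, a i) ∧ ∑ i ∈ F, a i ≤ N) :
    ∃ H : Finset (Fin d), d / 2 ≤ H.card ∧ (subsetSums a H).card ≤ L ^ 24 := by
  obtain ⟨H, -, hH⟩ := Finset.exists_subset_card_eq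
    (s := (Finset.univ : Finset (Fin d))) (n := d / 2)
    (by rw [Finset.card_univ, Fintype.card_fin]; exact Nat.div_le_self _ _)
  by_cases hc : L ^ 7 ≤ (subsetSums a H).card
  · refine ⟨Hᶜ, by rw [Finset.card_compl, Fintype.card_fin, hH]; omega, ?_⟩
    have hpos : ∀ G : Finset (Fin d), ∀ x ∈ subsetSums a G, 0 < x := by
      intro G x hx
      obtain ⟨s, -, hs, rfl⟩ := mem_subsetSums.1 hx
      exact Finset.sum_pos (fun i _ => ha i) hs
    refine card_le_of_bipartite hN hL2 hL (subsetSums a H) _ (hpos _) (hpos _) ?_ hc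
    intro b hb x hx
    obtain ⟨s, hsH, hs, rfl⟩ := mem_subsetSums.1 hb
    obtain ⟨s', hs'H, hs', rfl⟩ := mem_subsetSums.1 hx
    have hdisj : Disjoint s s' :=
      Disjoint.mono hsH hs'H disjoint_compl_left
    rw [← Finset.sum_union hdisj]
    exact h _ (hs.mono Finset.subset_union_left)
  · exact ⟨H, hH.ge, (not_le.1 hc).le.trans (Nat.pow_le_pow_right (by omega) (by norm_num))⟩

theorem mul_factorial_mul_pow_lt_choose {L w k D : ℕ} (hw : 0 < w) (hk : 0 < k) (hLw : L < 2 ^ w)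
    (hD : 2 ^ 25 * w ^ 2 * k ≤ D) : L ^ 24 * (w.factorial * k ^ w) < D.choose w := by
  have h1 : 2 ^ 24 * w ^ 2 * k ≤ D + 1 - w := by
    have : w ≤ 2 ^ 24 * w ^ 2 * k := by
      calc w ≤ w ^ 2 := Nat.le_self_pow (by norm_num) w
        _ ≤ 2 ^ 24 * w ^ 2 := Nat.le_mul_of_pos_left _ (by norm_num)
        _ ≤ _ := Nat.le_mul_of_pos_right _ hk
    have h2 : 2 ^ 25 * w ^ 2 * k = 2 ^ 24 * w ^ 2 * k + 2 ^ 24 * w ^ 2 * k := by ring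
    omega
  have hf := Nat.factorial_le_pow w
  have h3 : w.factorial * (L ^ 24 * (w.factorial * k ^ w)) < w.factorial * D.choose w := by
    rw [← Nat.descFactorial_eq_factorial_mul_choose]
    calc w.factorial * (L ^ 24 * (w.factorial * k ^ w))
        < w.factorial * ((2 ^ w) ^ 24 * (w.factorial * k ^ w)) := by
          have : 0 < w.factorial := w.factorial_pos
          gcongr
      _ ≤ w ^ w * ((2 ^ w) ^ 24 * (w ^ w * k ^ w)) := by gcongr
      _ = (2 ^ 24 * w ^ 2 * k) ^ w := by
          rw [mul_pow, mul_pow, ← pow_mul, ← pow_mul, ← pow_mul, mul_comm w 24, mul_comm 2 w,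
            pow_mul w w 2]
          ring
      _ ≤ (D + 1 - w) ^ w := Nat.pow_le_pow_left h1 w
      _ ≤ D.descFactorial w := Nat.pow_sub_le_descFactorial _ _
  exact Nat.lt_of_mul_lt_mul_left h3

theorem dim_lt_of_subset_sums {L N d w M : ℕ} (hN : N < 2 ^ L) (hL2 : 2 ≤ L)
    (hL : 24 * L ^ (8 * L + 34) * 2 ^ (L ^ 2) ≤ 3 ^ (L ^ 2)) (hw : 0 < w) (hLw : L < 2 ^ w)
    (hM : 0 < M) (hLM : L ^ 2 < M.factorial) (a : Fin d → ℕ) (ha : ∀ i, 0 < a i)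
    (h : ∀ F : Finset (Fin d), F.Nonempty →
      IsPurePower (∑ i ∈ F, a i) ∧ ∑ i ∈ F, a i ≤ N) :
    d < 2 ^ 28 * w ^ 2 * M := by
  by_contra! hd
  obtain ⟨H, hH, hHc⟩ := exists_half_few_subset_sums hN hL2 hL a ha h
  have hD : 2 ^ 25 * w ^ 2 * (4 * M) ≤ d / 2 := by
    rw [Nat.le_div_iff_mul_le (by norm_num)]
    refine le_trans (le_of_eq ?_) hd
    ring
  have h1 := mul_factorial_mul_pow_lt_choose hw (by omega) hLw hD
  obtain ⟨x, hx, hap⟩ := exists_progression_subset_sums a ha H (subsetSums a H)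
    (fun s hs hne => mem_subsetSums.2 ⟨s, hs, hne, rfl⟩) (4 * M) w hw
    ((Nat.mul_le_mul_right _ hHc).trans_lt (h1.trans_le (Nat.choose_le_choose w hH)))
  obtain ⟨m, hm1, hm2⟩ := factorial_le_of_progression hx hN (K := 4 * M) (by omega)
    fun j hj hjk => by
      obtain ⟨s, -, hne, hs⟩ := hap j hj hjk
      rw [← hs]
      exact h s hne
  have h2 : M.factorial ≤ m.factorial := Nat.factorial_le (by omega)
  omega

theorem pow_self_le_factorial_two_mul (r : ℕ) : r ^ r ≤ (2 * r).factorial := by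
  have h1 := Nat.factorial_mul_pow_le_factorial (m := r) (n := r)
  rw [← two_mul] at h1
  calc r ^ r ≤ (r + 1) ^ r := Nat.pow_le_pow_left (by omega) r
    _ ≤ r.factorial * (r + 1) ^ r := Nat.le_mul_of_pos_left _ r.factorial_pos
    _ ≤ _ := h1

theorem four_pow_le_pow_ceil {y : ℝ} (hy : 3 ≤ y) {w : ℕ} (hw : (w : ℝ) ≤ 6 * y) :
    4 ^ w ≤ ⌈18 * y / Real.log y⌉₊ ^ ⌈18 * y / Real.log y⌉₊ := by
  set r := ⌈18 * y / Real.log y⌉₊ with hr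
  have hy0 : 0 < y := by linarith
  have hlog : 0 < Real.log y := Real.log_pos (by linarith)
  have hr1 : 18 * y / Real.log y ≤ r := Nat.le_ceil _
  have hsq : Real.log y ≤ 2 * Real.sqrt y := by
    have h1 := Real.log_le_self (Real.sqrt_nonneg y)
    rw [Real.log_sqrt hy0.le] at h1
    linarith
  have hsr : Real.sqrt y ≤ r := by
    refine le_trans ?_ hr1
    rw [le_div_iff₀ hlog]
    have h2 := Real.mul_self_sqrt hy0.le
    nlinarith [Real.sqrt_nonneg y]
  have hr0 : (0 : ℝ) < r := lt_of_lt_of_le (Real.sqrt_pos.2 hy0) hsr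
  have hlr : Real.log y / 2 ≤ Real.log r := by
    rw [← Real.log_sqrt hy0.le]
    exact Real.log_le_log (Real.sqrt_pos.2 hy0) hsr
  have hlog4 : Real.log 4 ≤ 3 / 2 := by
    have h1 : Real.log 4 = 2 * Real.log 2 := by
      rw [show (4 : ℝ) = 2 ^ 2 by norm_num, Real.log_pow]; norm_num
    have := Real.log_two_lt_d9
    rw [h1]; linarith
  have hlog40 : 0 ≤ Real.log 4 := Real.log_nonneg (by norm_num)
  have hmain : (4 : ℝ) ^ w ≤ (r : ℝ) ^ r := by
    rw [← Real.log_le_log_iff (by positivity) (by positivity), Real.log_pow, Real.log_pow]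
    calc (w : ℝ) * Real.log 4 ≤ (6 * y) * (3 / 2) := mul_le_mul hw hlog4 hlog40 (by positivity)
      _ = 18 * y / Real.log y * (Real.log y / 2) := by field_simp; norm_num
      _ ≤ r * Real.log r := mul_le_mul hr1 hlr (by positivity) hr0.le
  exact_mod_cast hmain

theorem natLog_natLog_le {N : ℕ} (hN : 3 ≤ Real.log (Real.log N)) :
    ((Nat.log 2 (Nat.log 2 N + 1) + 1 : ℕ) : ℝ) ≤ 6 * Real.log (Real.log N) := by
  set y := Real.log (Real.log N) with hy
  have hN0 : N ≠ 0 := by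
    rintro rfl
    simp at hy
    linarith
  have hlog0 : 0 ≤ Real.log N := Real.log_natCast_nonneg N
  have hlogN : 1 ≤ Real.log N := by
    by_contra! hlt
    have := Real.log_nonpos hlog0 hlt.le
    linarith
  have h2 : (1 / 2 : ℝ) ≤ Real.log 2 := by have := Real.log_two_gt_d9; linarith
  have hkey : ∀ m : ℕ, m ≠ 0 → ((Nat.log 2 m : ℕ) : ℝ) ≤ 2 * Real.log m := by
    intro m hm
    have h3 : ((2 ^ Nat.log 2 m : ℕ) : ℝ) ≤ m := by
      exact_mod_cast Nat.pow_log_le_self 2 hm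
    have h4 := Real.log_le_log (by positivity) h3
    push_cast at h4
    rw [Real.log_pow] at h4
    nlinarith [(Nat.cast_nonneg (Nat.log 2 m) : (0 : ℝ) ≤ _)]
  have h5 := hkey N hN0
  have h6 := hkey (Nat.log 2 N + 1) (by omega)
  have h7 : Real.log ((Nat.log 2 N + 1 : ℕ) : ℝ) ≤ Real.log (3 * Real.log N) := by
    refine Real.log_le_log (by positivity) ?_
    push_cast
    linarith
  rw [Real.log_mul (by norm_num) (by linarith), ← hy] at h7
  have h8 : Real.log 3 ≤ 3 - 1 := Real.log_le_sub_one_of_pos (by norm_num)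
  push_cast at h6 h7 ⊢
  linarith

/-- Subset sums in pure powers, distinct case:
`d ≪ (log log N)³ / log log log N`. -/
theorem stmt_8 :
    ∃ C : ℝ, 0 < C ∧ ∃ N₀ : ℕ, ∀ N : ℕ, N₀ ≤ N →
      ∀ (d : ℕ) (a : Fin d → ℕ),
        Function.Injective a →
        (∀ i, 0 < a i) →
        (∀ F : Finset (Fin d), F.Nonempty →
          IsPurePower (∑ i ∈ F, a i) ∧ ∑ i ∈ F, a i ≤ N) →
        (d : ℝ) ≤ C * (Real.log (Real.log N)) ^ 3 /
          Real.log (Real.log (Real.log N)) := by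
  obtain ⟨L₀, hL₀⟩ := Filter.eventually_atTop.1 eventually_pow_le_pow_sq
  have hlarge : ∀ᶠ N : ℕ in Filter.atTop, 3 ≤ Real.log (Real.log N) :=
    (Real.tendsto_log_atTop.comp (Real.tendsto_log_atTop.comp
      tendsto_natCast_atTop_atTop)).eventually_ge_atTop 3
  obtain ⟨N₁, hN₁⟩ := Filter.eventually_atTop.1 hlarge
  refine ⟨2 ^ 28 * 36 * 38, by norm_num, max (max N₁ (2 ^ L₀)) 2, fun N hN d a _ ha h => ?_⟩
  have hN1 : N₁ ≤ N := (le_max_left _ _).trans ((le_max_left _ _).trans hN)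
  have hN2 : 2 ^ L₀ ≤ N := (le_max_right _ _).trans ((le_max_left _ _).trans hN)
  have hN3 : 2 ≤ N := (le_max_right _ _).trans hN
  have hy := hN₁ N hN1
  have hw := natLog_natLog_le hy
  set y := Real.log (Real.log N) with hydef
  set L := Nat.log 2 N + 1 with hLdef
  set w := Nat.log 2 L + 1 with hwdef
  have hy0 : 0 < y := by linarith
  have hlogy : 0 < Real.log y := Real.log_pos (by linarith)
  set r := ⌈18 * y / Real.log y⌉₊ with hr
  have hr0 : 0 < r := Nat.ceil_pos.2 (by positivity)
  have hNL : N < 2 ^ L := Nat.lt_pow_succ_log_self (by norm_num) N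
  have hLw : L < 2 ^ w := Nat.lt_pow_succ_log_self (by norm_num) L
  have hLL : L₀ ≤ L := by
    have := Nat.le_log_of_pow_le (by norm_num) hN2
    omega
  have hL2 : 2 ≤ L := by
    have : 0 < Nat.log 2 N := Nat.log_pos (by norm_num) hN3
    omega
  have hLM : L ^ 2 < (2 * r).factorial := by
    calc L ^ 2 < (2 ^ w) ^ 2 := Nat.pow_lt_pow_left hLw (by norm_num)
      _ = 4 ^ w := by rw [← pow_mul, mul_comm, pow_mul]; norm_num
      _ ≤ r ^ r := four_pow_le_pow_ceil hy hw
      _ ≤ _ := pow_self_le_factorial_two_mul r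
  have hd := dim_lt_of_subset_sums hNL hL2 (hL₀ L hLL) (Nat.succ_pos _) hLw (by omega) hLM a ha h
  have hd' : (d : ℝ) ≤ 2 ^ 28 * (w : ℝ) ^ 2 * (2 * r) := by exact_mod_cast hd.le
  have hr2 : (r : ℝ) ≤ 19 * y / Real.log y := by
    have h1 : (r : ℝ) < 18 * y / Real.log y + 1 := Nat.ceil_lt_add_one (by positivity)
    have h2 : 1 ≤ y / Real.log y := by
      rw [le_div_iff₀ hlogy, one_mul]
      exact Real.log_le_self hy0.le
    have h3 : 19 * y / Real.log y = 18 * y / Real.log y + y / Real.log y := by ring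
    linarith
  calc (d : ℝ) ≤ 2 ^ 28 * (w : ℝ) ^ 2 * (2 * r) := hd'
    _ ≤ 2 ^ 28 * (6 * y) ^ 2 * (2 * (19 * y / Real.log y)) := by gcongr
    _ = _ := by ring
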